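/- arXiv:2410.21460 — 2 statements merged into one kernel-verified Lean document; each statement's English description precedes it below -/
import Mathlib

section
/- There exists an element f ∈ Homeo¹(ℝ²) such that for every n ∈ ℕ, f is not differentiable at the point (2⁻ⁿ, 0). In particular there is an element of Homeo¹(ℝ²) whose set of non-differentiable points is infinite and has an accumulation point. -/
open Filter Topology

noncomputable section

abbrev Plane : Type := ℝ × ℝ

abbrev ProjLine : Type := Projectivization ℝ Plane

instance : TopologicalSpace ProjLine := instTopologicalSpaceQuotient

/-- A regular (C¹, 1-periodic, injective on `[0,1)`, nowhere-vanishing derivative)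
parameterization of a simple closed C¹ curve. -/
def IsRegParam (γ : ℝ → Plane) : Prop :=
  ContDiff ℝ 1 γ ∧ Function.Periodic γ 1 ∧ Set.InjOn γ (Set.Ico 0 1) ∧ ∀ t, deriv γ t ≠ 0

/-- `Γ` is a simple closed C¹ curve. -/
def IsC1Curve (Γ : Set Plane) : Prop := ∃ γ : ℝ → Plane, IsRegParam γ ∧ Γ = Set.range γ

/-- `Γ` is a simple closed C¹ curve through `p` with tangent line `ℓ` at `p`. -/
def TangentAt (Γ : Set Plane) (p : Plane) (ℓ : ProjLine) : Prop :=
  ∃ (γ : ℝ → Plane) (t₀ : ℝ) (h : IsRegParam γ),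
    Γ = Set.range γ ∧ γ t₀ = p ∧ ℓ = Projectivization.mk ℝ (deriv γ t₀) (h.2.2.2 t₀)

/-- `f` maps every simple closed C¹ curve to a simple closed C¹ curve. -/
def MapsC1 (f : Plane → Plane) : Prop := ∀ Γ : Set Plane, IsC1Curve Γ → IsC1Curve (f '' Γ)

/-- Membership in `Homeo¹(ℝ²)`. -/
def InHomeo1 (f : Plane ≃ₜ Plane) : Prop := MapsC1 ⇑f ∧ MapsC1 ⇑f.symm

/-- `φ` is a homeomorphism of projective tangent spaces induced by `f` at `p`. -/
def InducesAt (f : Plane → Plane) (p : Plane) (φ : ProjLine ≃ₜ ProjLine) : Prop :=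
  ∀ (Γ : Set Plane) (ℓ : ProjLine), TangentAt Γ p ℓ →
    IsC1Curve (f '' Γ) ∧ TangentAt (f '' Γ) (f p) (φ ℓ)

/-- The secant direction from `q` to `x` (junk value if `x = q`). -/
def secantDir (q x : Plane) : ProjLine :=
  if h : x = q then Projectivization.mk ℝ (1, 0) (by simp) else
    Projectivization.mk ℝ (x - q) (sub_ne_zero.mpr h)

/-- The sequence `x` converges along the line `ℓ` to `p`. -/
def ConvAlong (p : Plane) (ℓ : ProjLine) (x : ℕ → Plane) : Prop :=
  (∀ n, x n ≠ p) ∧ Tendsto x atTop (𝓝 p) ∧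
    Tendsto (fun n => secantDir p (x n)) atTop (𝓝 ℓ)

/-- `(x, k)` is a transverse sequence for `(p, ℓ)`. -/
def TransverseFor (p : Plane) (ℓ : ProjLine) (x : ℕ → Plane) (k : ℕ → ProjLine) : Prop :=
  ConvAlong p ℓ x ∧
    ∀ φ : ℕ → ℕ, StrictMono φ →
      ¬ Tendsto (fun n => (x (φ n), k (φ n))) atTop (𝓝 (p, ℓ))

/-- `(x, k)` is a transverse sequence. -/
def Transverse (x : ℕ → Plane) (k : ℕ → ProjLine) : Prop := ∃ p ℓ, TransverseFor p ℓ x k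

section Curves

/-- A continuous real function with positive derivative off a countable set is monotone. -/
theorem monotone_of_hasDerivAt_pos_off_countable {F F' : ℝ → ℝ} {S : Set ℝ} (hS : S.Countable)
    (hF : Continuous F) (hd : ∀ t ∉ S, HasDerivAt F (F' t) t) (hpos : ∀ t ∉ S, 0 < F' t) :
    Monotone F := by
  intro x y hxy
  by_contra! hlt
  obtain ⟨k, hk, hkS⟩ : ∃ k ∈ Set.Ioo (F y) (F x), k ∉ F '' S := by
    by_contra! h
    exact hlt.not_ge (Cardinal.Real.Ioo_countable_iff.1 (Set.Countable.mono h (hS.image F)))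
  have hcomp : IsCompact (Set.Icc x y ∩ {t | k ≤ F t}) :=
    isCompact_Icc.inter_right (isClosed_le continuous_const hF)
  obtain ⟨z, ⟨hz, hkz⟩, hmax⟩ := hcomp.exists_isGreatest ⟨x, ⟨le_rfl, hxy⟩, hk.2.le⟩
  have hzy : z < y := lt_of_le_of_ne hz.2 fun h => by
    subst h; exact absurd hk.1 (not_lt.2 hkz)
  have hright : ∀ᶠ t in 𝓝[>] z, F t < k := by
    filter_upwards [Ioo_mem_nhdsGT hzy] with t ht
    by_contra! h
    exact absurd (hmax ⟨⟨hz.1.trans ht.1.le, ht.2.le⟩, h⟩) (not_le.2 ht.1)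
  have hzk : F z = k := le_antisymm
    (le_of_tendsto (hF.continuousAt.mono_left nhdsWithin_le_nhds)
      (hright.mono fun t ht => ht.le)) hkz
  have hzS : z ∉ S := fun h => hkS ⟨z, h, hzk⟩
  have hslope := (hasDerivAt_iff_tendsto_slope.1 (hd z hzS)).mono_left
    (nhdsWithin_mono z (fun t (ht : z < t) => ht.ne') : 𝓝[>] z ≤ 𝓝[≠] z)
  obtain ⟨t, ht, htz, htk⟩ := ((hslope.eventually (lt_mem_nhds (hpos z hzS))).and
    (Filter.Eventually.and (self_mem_nhdsWithin : Set.Ioi z ∈ 𝓝[>] z) hright)).exists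
  rw [slope_def_field] at ht
  have htz' : z < t := htz
  have := (div_pos_iff_of_pos_right (sub_pos.2 htz')).1 ht
  linarith

/-- A continuous real function with positive derivative off a countable set is strictly
monotone. -/
theorem strictMono_of_hasDerivAt_pos_off_countable {F F' : ℝ → ℝ} {S : Set ℝ} (hS : S.Countable)
    (hF : Continuous F) (hd : ∀ t ∉ S, HasDerivAt F (F' t) t) (hpos : ∀ t ∉ S, 0 < F' t) :
    StrictMono F := by
  have hmono := monotone_of_hasDerivAt_pos_off_countable hS hF hd hpos
  intro x y hxy
  refine lt_of_le_of_ne (hmono hxy.le) fun heq => ?_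
  obtain ⟨z, hz, hzS⟩ : ∃ z ∈ Set.Ioo x y, z ∉ S := by
    by_contra! h
    exact hxy.not_ge (Cardinal.Real.Ioo_countable_iff.1 (Set.Countable.mono h hS))
  have hconst : F =ᶠ[𝓝 z] fun _ => F x := by
    filter_upwards [Ioo_mem_nhds hz.1 hz.2] with t ht
    exact le_antisymm ((hmono ht.2.le).trans heq.ge) (hmono ht.1.le)
  have := (hd z hzS).unique ((hasDerivAt_const z (F x)).congr_of_eventuallyEq hconst)
  exact (hpos z hzS).ne' this

/-- A continuous function which has a continuous derivative off a countable set has it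
everywhere. -/
theorem hasDerivAt_of_hasDerivAt_off_countable {E : Type*} [NormedAddCommGroup E]
    [NormedSpace ℝ E] [CompleteSpace E] {c a : ℝ → E} {S : Set ℝ} (hS : S.Countable)
    (hc : Continuous c) (ha : Continuous a) (hd : ∀ t ∉ S, HasDerivAt c (a t) t) (t : ℝ) :
    HasDerivAt c (a t) t := by
  have hEq : c = fun x => c 0 + ∫ u in (0 : ℝ)..x, a u := by
    funext x
    rw [MeasureTheory.integral_eq_of_hasDerivAt_off_countable c a hS hc.continuousOn
      (fun x hx => hd x hx.2) (ha.intervalIntegrable _ _)]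
    abel
  rw [hEq]
  exact (intervalIntegral.integral_hasDerivAt_right (ha.intervalIntegrable _ _)
    (ha.stronglyMeasurableAtFilter _ _) ha.continuousAt).const_add _

theorem Function.Periodic.exists_pos_le_norm {E : Type*} [NormedAddCommGroup E]
    {a : ℝ → E} (ha : Continuous a) (hper : Function.Periodic a 1) (h0 : ∀ t, a t ≠ 0) :
    ∃ m > 0, ∀ t, m ≤ ‖a t‖ := by
  obtain ⟨t₀, -, ht₀⟩ := (isCompact_Icc (a := (0 : ℝ)) (b := 1)).exists_isMinOn
    ⟨0, by simp⟩ ha.norm.continuousOn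
  refine ⟨‖a t₀‖, norm_pos_iff.2 (h0 _), fun t => ?_⟩
  obtain ⟨u, hu, hut⟩ := hper.exists_mem_Ico₀ one_pos t
  rw [hut]
  exact ht₀ ⟨hu.1, hu.2.le⟩

theorem Function.Periodic.uniformContinuous_of_continuous {E : Type*} [NormedAddCommGroup E]
    {a : ℝ → E} (ha : Continuous a) (hper : Function.Periodic a 1) : UniformContinuous a := by
  rw [Metric.uniformContinuous_iff]
  intro ε hε
  obtain ⟨δ, hδ, h⟩ := Metric.uniformContinuousOn_iff.1
    ((isCompact_Icc (a := (-1 : ℝ)) (b := 2)).uniformContinuousOn_of_continuous ha.continuousOn)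
    ε hε
  refine ⟨min δ 1, by positivity, fun x y hxy => ?_⟩
  have hx : a (x - ⌊x⌋) = a x := by
    simpa only [mul_one] using hper.sub_int_mul_eq (x := x) ⌊x⌋
  have hy : a (y - ⌊x⌋) = a y := by
    simpa only [mul_one] using hper.sub_int_mul_eq (x := y) ⌊x⌋
  rw [← hx, ← hy]
  have h1 := Int.floor_le x
  have h2 := Int.lt_floor_add_one x
  have h3 := abs_lt.1 (Real.dist_eq x y ▸ hxy.trans_le (min_le_right _ _))
  refine h _ ⟨by linarith, by linarith⟩ _ ⟨by linarith, by linarith⟩ ?_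
  simpa using hxy.trans_le (min_le_left _ _)

variable {E : Type*} [NormedAddCommGroup E] [InnerProductSpace ℝ E] [CompleteSpace E]

/-- A continuous nowhere vanishing periodic vector field along `ℝ` has positive inner product
with a `C¹` periodic one. -/
theorem exists_periodic_hasDerivAt_inner_pos {a : ℝ → E} (ha : Continuous a)
    (hper : Function.Periodic a 1) (h0 : ∀ t, a t ≠ 0) :
    ∃ b b' : ℝ → E, (∀ t, HasDerivAt b (b' t) t) ∧ Continuous b' ∧ Function.Periodic b 1 ∧
      Function.Periodic b' 1 ∧ ∀ t, 0 < inner ℝ (a t) (b t) := by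
  obtain ⟨m, hm, hma⟩ := Function.Periodic.exists_pos_le_norm ha hper h0
  obtain ⟨δ, hδ, h⟩ := Metric.uniformContinuous_iff.1
    (Function.Periodic.uniformContinuous_of_continuous ha hper) m hm
  have haInt : ∀ x y, IntervalIntegrable a MeasureTheory.volume x y := fun x y =>
    ha.intervalIntegrable x y
  have hprim : ∀ t, HasDerivAt (fun t => ∫ u in (0 : ℝ)..t, a u) (a t) t := fun t =>
    intervalIntegral.integral_hasDerivAt_right (haInt _ _)
      (ha.stronglyMeasurableAtFilter _ _) ha.continuousAt
  refine ⟨fun t => ∫ u in t..(t + δ / 2), a u, fun t => a (t + δ / 2) - a t, fun t => ?_,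
    by fun_prop, fun t => ?_, fun t => ?_, fun t => ?_⟩
  · have hEq : (fun t => ∫ u in t..(t + δ / 2), a u) =
        fun t => (∫ u in (0 : ℝ)..(t + δ / 2), a u) - ∫ u in (0 : ℝ)..t, a u := by
      funext t
      rw [intervalIntegral.integral_interval_sub_left (haInt _ _) (haInt _ _)]
    rw [hEq]
    exact ((hprim (t + δ / 2)).comp_add_const t (δ / 2)).sub (hprim t)
  · have := intervalIntegral.integral_comp_add_right (a := t) (b := t + δ / 2) a 1
    simp only [hper _] at this
    simp only [this]
    congr 1; ring
  · simp only [hper t, add_right_comm t 1, hper _]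
  · have hcomm := (innerSL ℝ (a t)).intervalIntegral_comp_comm (haInt t (t + δ / 2))
    simp only [innerSL_apply_apply] at hcomm
    rw [← hcomm]
    refine intervalIntegral.intervalIntegral_pos_of_pos_on
      (Continuous.intervalIntegrable (by fun_prop) _ _) (fun u hu => ?_) (by linarith)
    have hclose : ‖a u - a t‖ < ‖a t‖ := by
      rw [← dist_eq_norm]
      refine (h ?_).trans_le (hma t)
      rw [Real.dist_eq, abs_lt]
      constructor <;> linarith [hu.1, hu.2]
    have h1 : inner ℝ (a t) (a u) = ‖a t‖ ^ 2 + inner ℝ (a t) (a u - a t) := by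
      rw [inner_sub_right, real_inner_self_eq_norm_sq]; ring
    have h2 := neg_le_of_abs_le (abs_real_inner_le_norm (a t) (a u - a t))
    have h3 : 0 < ‖a t‖ := norm_pos_iff.2 (h0 t)
    rw [h1]
    nlinarith

/-- A continuous function commuting with a translation up to a positive constant is
surjective. -/
theorem surjective_of_add_one_eq {s : ℝ → ℝ} (hs : Continuous s) {L : ℝ} (hL : 0 < L)
    (h : ∀ t, s (t + 1) = s t + L) : Function.Surjective s := by
  have hn : ∀ n : ℕ, s n = s 0 + n * L := by
    intro n
    induction n with
    | zero => simp
    | succ k ih => push_cast; rw [h, ih]; ring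
  have hn' : ∀ n : ℕ, s (-n) = s 0 - n * L := by
    intro n
    induction n with
    | zero => simp
    | succ k ih =>
      have := h (-((k : ℝ) + 1))
      rw [show -((k : ℝ) + 1) + 1 = -k by ring, ih] at this
      push_cast; linarith
  intro y
  obtain ⟨n, hn1⟩ := exists_nat_gt (|y - s 0| / L)
  have hb := abs_lt.1 ((div_lt_iff₀ hL).1 hn1)
  exact mem_range_of_exists_le_of_exists_ge hs ⟨-n, by rw [hn']; linarith⟩
    ⟨n, by rw [hn]; linarith⟩

/-- A closed curve whose derivative off a countable set is a positive multiple of a continuous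
nowhere vanishing field has a regular reparameterization. -/
theorem exists_regular_reparam {c a : ℝ → E} {μ : ℝ → ℝ} {S : Set ℝ} (hS : S.Countable)
    (hc : Continuous c) (hcper : Function.Periodic c 1) (ha : Continuous a)
    (haper : Function.Periodic a 1) (h0 : ∀ t, a t ≠ 0) (hμ : ∀ t ∉ S, 0 < μ t)
    (hd : ∀ t ∉ S, HasDerivAt c (μ t • a t) t) :
    ∃ σ : ℝ ≃ ℝ, StrictMono σ ∧ (∀ t, σ (t + 1) = σ t + 1) ∧
      ∃ v : ℝ → E, Continuous v ∧ (∀ t, v t ≠ 0) ∧ ∀ t, HasDerivAt (c ∘ σ) (v t) t := by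
  obtain ⟨b, b', hb, hb', hbper, hb'per, hab⟩ := exists_periodic_hasDerivAt_inner_pos ha haper h0
  have hbc : Continuous b := continuous_iff_continuousAt.2 fun t => (hb t).continuousAt
  have hcb' : Continuous fun u => inner ℝ (c u) (b' u) := by fun_prop
  set s : ℝ → ℝ := fun t => inner ℝ (c t) (b t) - ∫ u in (0 : ℝ)..t, inner ℝ (c u) (b' u)
    with hs_def
  have hprim : ∀ t, HasDerivAt (fun t => ∫ u in (0 : ℝ)..t, inner ℝ (c u) (b' u))
      (inner ℝ (c t) (b' t)) t := fun t =>
    intervalIntegral.integral_hasDerivAt_right (hcb'.intervalIntegrable _ _)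
      (hcb'.stronglyMeasurableAtFilter _ _) hcb'.continuousAt
  have hs : Continuous s := (hc.inner hbc).sub
    (continuous_iff_continuousAt.2 fun t => (hprim t).continuousAt)
  have hsd : ∀ t ∉ S, HasDerivAt s (μ t * inner ℝ (a t) (b t)) t := fun t ht => by
    refine (((hd t ht).inner ℝ (hb t)).sub (hprim t)).congr_deriv ?_
    rw [real_inner_smul_left]; ring
  have hspos : ∀ t ∉ S, 0 < μ t * inner ℝ (a t) (b t) := fun t ht => mul_pos (hμ t ht) (hab t)
  have hsmono := strictMono_of_hasDerivAt_pos_off_countable hS hs hsd hspos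
  obtain ⟨L, hsL⟩ : ∃ L, ∀ t, s (t + 1) = s t + L := by
    refine ⟨-∫ u in (0 : ℝ)..(0 + 1), inner ℝ (c u) (b' u), fun t => ?_⟩
    have hper : Function.Periodic (fun u => inner ℝ (c u) (b' u)) 1 := fun u => by
      simp only [hcper u, hb'per u]
    have h1 := hper.intervalIntegral_add_eq 0 t
    have h2 := intervalIntegral.integral_add_adjacent_intervals
      (hcb'.intervalIntegrable 0 t) (hcb'.intervalIntegrable (μ := MeasureTheory.volume) t (t + 1))
    simp only [hs_def, hcper t, hbper t]
    linarith
  have hL : 0 < L := by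
    have := hsmono (show (0 : ℝ) < 0 + 1 by norm_num)
    rw [hsL] at this
    linarith
  have hsurj := surjective_of_add_one_eq hs hL hsL
  let τ : ℝ ≃ₜ ℝ := (StrictMono.orderIsoOfSurjective s hsmono hsurj).toHomeomorph
  have hτ : ∀ t, τ t = s t := fun t => rfl
  have hτs : ∀ x, s (τ.symm x) = x := fun x => by rw [← hτ, τ.apply_symm_apply]
  let σ : ℝ ≃ ℝ := (Equiv.mulLeft₀ L hL.ne').trans τ.symm.toEquiv
  have hσ : ∀ t, σ t = τ.symm (L * t) := fun t => rfl
  have hσs : ∀ t, s (σ t) = L * t := fun t => hτs _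
  have hσc : Continuous σ := τ.symm.continuous.comp (continuous_const.mul continuous_id)
  have hv : Continuous fun t => (L * (inner ℝ (a (σ t)) (b (σ t)))⁻¹) • a (σ t) :=
    ((continuous_const.mul (((ha.inner hbc).comp hσc).inv₀ fun t => (hab _).ne'))).smul
      (ha.comp hσc)
  refine ⟨σ, fun x y hxy => ?_, fun t => ?_, _, hv, fun t => ?_, ?_⟩
  · rw [← hsmono.lt_iff_lt, hσs, hσs]
    exact mul_lt_mul_of_pos_left hxy hL
  · apply hsmono.injective
    rw [hσs, hsL, hσs]; ring
  · exact smul_ne_zero (mul_pos hL (inv_pos.2 (hab _))).ne' (h0 _)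
  · refine hasDerivAt_of_hasDerivAt_off_countable (hS.preimage_of_injOn σ.injective.injOn)
      (hc.comp hσc) hv fun t ht => ?_
    have ht' : σ t ∉ S := ht
    have hσd : HasDerivAt σ ((μ (σ t) * inner ℝ (a (σ t)) (b (σ t))) / L)⁻¹ t := by
      refine HasDerivAt.of_local_left_inverse (f := fun x => s x / L) hσc.continuousAt
        ((hsd _ ht').div_const L) (div_pos (hspos _ ht') hL).ne'
        (Eventually.of_forall fun y => ?_)
      simp only [hσs]
      field_simp
    refine (HasDerivAt.scomp t (hd _ ht') hσd).congr_deriv ?_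
    have h1 := (hμ _ ht').ne'
    have h2 := (hab (σ t)).ne'
    rw [smul_smul]
    congr 1
    field_simp

end Curves

section DirectionallyC1

variable {E : Type*} [NormedAddCommGroup E]

/-- Off a countable set the derivative of `f` is a positive multiple of a linear map which extends
to a continuous family of invertible linear maps on the whole space. -/
def IsDirectionallyC1 [NormedSpace ℝ E] (f : E → E) : Prop :=
  ∃ (K : Set E) (A : E → E →L[ℝ] E), K.Countable ∧ Continuous A ∧ (∀ x, IsUnit (A x)) ∧
    ∀ x ∉ K, ∃ μ : ℝ, 0 < μ ∧ HasFDerivAt f (μ • A x) x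

theorem IsDirectionallyC1.symm [NormedSpace ℝ E] [CompleteSpace E] {f : E ≃ₜ E}
    (hf : IsDirectionallyC1 f) : IsDirectionallyC1 f.symm := by
  obtain ⟨K, A, hK, hA, hu, hd⟩ := hf
  refine ⟨f '' K, fun y => Ring.inverse (A (f.symm y)), hK.image f, ?_, fun y => ?_,
    fun y hy => ?_⟩
  · refine continuous_iff_continuousAt.2 fun y => ?_
    obtain ⟨u, hu'⟩ := hu (f.symm y)
    refine ContinuousAt.comp (f := fun y => A (f.symm y)) (g := Ring.inverse) ?_
      (hA.comp f.symm.continuous).continuousAt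
    rw [← hu']
    exact NormedRing.inverse_continuousAt u
  · obtain ⟨u, hu'⟩ := hu (f.symm y)
    simp only [← hu', Ring.inverse_unit]
    exact u⁻¹.isUnit
  · have hx : f.symm y ∉ K := fun h => hy ⟨_, h, f.apply_symm_apply y⟩
    obtain ⟨μ, hμ, hder⟩ := hd _ hx
    refine ⟨μ⁻¹, inv_pos.2 hμ, ?_⟩
    obtain ⟨u, hu'⟩ := hu (f.symm y)
    let w : (E →L[ℝ] E)ˣ := Units.mk0 μ hμ.ne' • u
    have hw : (w : E →L[ℝ] E) = μ • A (f.symm y) := by rw [← hu']; rfl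
    have hw' : ((w⁻¹ : (E →L[ℝ] E)ˣ) : E →L[ℝ] E) = μ⁻¹ • Ring.inverse (A (f.symm y)) := by
      rw [← hu', Ring.inverse_unit]
      simp [w]
      rfl
    rw [← hw] at hder
    rw [← hw']
    exact HasFDerivAt.of_local_left_inverse
      (f' := ContinuousLinearEquiv.unitsEquiv ℝ E w) f.symm.continuous.continuousAt hder
      (Eventually.of_forall f.apply_symm_apply)

theorem IsRegParam.fract_eq {γ : ℝ → Plane} (hγ : IsRegParam γ) {x y : ℝ} (h : γ x = γ y) :
    Int.fract x = Int.fract y := by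
  have hfr : ∀ x, γ (Int.fract x) = γ x := fun x => by
    rw [← Int.self_sub_floor]
    simpa only [mul_one] using hγ.2.1.sub_int_mul_eq (x := x) ⌊x⌋
  exact hγ.2.2.1 ⟨Int.fract_nonneg x, Int.fract_lt_one x⟩ ⟨Int.fract_nonneg y, Int.fract_lt_one y⟩
    (by rw [hfr, hfr, h])

theorem IsRegParam.eq_of_abs_sub_lt {γ : ℝ → Plane} (hγ : IsRegParam γ) {x y : ℝ} (h : γ x = γ y)
    (hxy : |x - y| < 1) : x = y := by
  obtain ⟨z, hz⟩ := Int.fract_eq_fract.1 (hγ.fract_eq h)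
  rw [hz, ← Int.cast_abs, ← Int.cast_one, Int.cast_lt, Int.abs_lt_one_iff] at hxy
  rw [hxy] at hz
  exact sub_eq_zero.1 (by simpa using hz)

theorem IsRegParam.countable_preimage {γ : ℝ → Plane} (hγ : IsRegParam γ) {K : Set Plane}
    (hK : K.Countable) : (γ ⁻¹' K).Countable := by
  have h0 : ∀ n : ℤ, (Set.Ico (n : ℝ) (n + 1) ∩ γ ⁻¹' K).Countable := fun n => by
    refine Set.countable_of_injective_of_countable_image (f := γ) (fun x hx y hy h => ?_)
      (hK.mono ?_)
    · refine hγ.eq_of_abs_sub_lt h (abs_lt.2 ⟨?_, ?_⟩)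
      · linarith [hx.1.1, hy.1.2]
      · linarith [hx.1.2, hy.1.1]
    · rintro _ ⟨x, hx, rfl⟩
      exact hx.2
  refine (Set.countable_iUnion h0).mono fun t ht => ?_
  rw [Set.mem_iUnion]
  exact ⟨⌊t⌋, ⟨Int.floor_le t, Int.lt_floor_add_one t⟩, ht⟩

theorem IsDirectionallyC1.mapsC1 [InnerProductSpace ℝ E] [CompleteSpace E] {f : E ≃ₜ E}
    (hf : IsDirectionallyC1 f) (e : E ≃L[ℝ] Plane) : MapsC1 (fun x => e (f (e.symm x))) := by
  obtain ⟨K, A, hK, hA, hu, hd⟩ := hf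
  rintro _ ⟨γ, hγ, rfl⟩
  have hγd : ∀ t, HasDerivAt γ (deriv γ t) t := fun t =>
    (hγ.1.differentiable one_ne_zero t).hasDerivAt
  have hγ'c : Continuous (deriv γ) := hγ.1.continuous_deriv le_rfl
  have hγ'per : Function.Periodic (deriv γ) 1 := fun t => by
    rw [← deriv_comp_add_const, hγ.2.1.funext]
  have hS : (γ ⁻¹' (e '' K)).Countable := hγ.countable_preimage (hK.image e)
  have hmem : ∀ t ∉ γ ⁻¹' (e '' K), e.symm (γ t) ∉ K := fun t ht h =>
    ht ⟨_, h, e.apply_symm_apply _⟩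
  choose! μ hμ hder using hd
  obtain ⟨σ, hσmono, hσ1, v, hvc, hv0, hv⟩ := exists_regular_reparam
    (c := fun t => f (e.symm (γ t)))
    (a := fun t => A (e.symm (γ t)) (e.symm (deriv γ t))) (μ := fun t => μ (e.symm (γ t))) hS
    (f.continuous.comp (e.symm.continuous.comp hγ.1.continuous))
    (fun t => by simp only [hγ.2.1 t])
    ((hA.comp (e.symm.continuous.comp hγ.1.continuous)).clm_apply (e.symm.continuous.comp hγ'c))
    (fun t => by simp only [hγ.2.1 t, hγ'per t])
    (fun t h => by
      obtain ⟨u, hu'⟩ := hu (e.symm (γ t))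
      have h1 : e.symm (deriv γ t) = 0 := by
        rw [← hu'] at h
        simpa [← mul_apply_eq_comp] using congrArg ((u⁻¹ : (E →L[ℝ] E)ˣ) : E →L[ℝ] E) h
      exact hγ.2.2.2 t (by simpa using h1))
    (fun t ht => hμ _ (hmem t ht))
    (fun t ht => by
      have := (hder _ (hmem t ht)).comp_hasDerivAt t
        ((e.symm : Plane →L[ℝ] E).hasFDerivAt.comp_hasDerivAt t (hγd t))
      simpa [Function.comp_def] using this)
  have hvd : ∀ t, HasDerivAt (fun t => e (f (e.symm (γ (σ t))))) (e (v t)) t := fun t =>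
    (e : E →L[ℝ] Plane).hasFDerivAt.comp_hasDerivAt t (hv t)
  have hvd' : deriv (fun t => e (f (e.symm (γ (σ t))))) = fun t => e (v t) :=
    funext fun t => (hvd t).deriv
  refine ⟨fun t => e (f (e.symm (γ (σ t)))), ⟨?_, fun t => ?_, fun x hx y hy hxy => ?_, fun t => ?_⟩,
    ?_⟩
  · rw [contDiff_one_iff_deriv, hvd']
    exact ⟨fun t => (hvd t).differentiableAt, e.continuous.comp hvc⟩
  · simp only [hσ1, hγ.2.1 (σ t)]
  · have h1 : γ (σ x) = γ (σ y) := by simpa using hxy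
    have hσ01 := hσ1 0
    rw [zero_add] at hσ01
    refine σ.injective (hγ.eq_of_abs_sub_lt h1 (abs_lt.2 ⟨?_, ?_⟩))
    · linarith [hσmono.monotone hx.1, hσmono hy.2]
    · linarith [hσmono.monotone hy.1, hσmono hx.2]
  · rw [hvd']
    simpa using hv0 t
  · rw [← Set.range_comp]
    exact (σ.surjective.range_comp (fun t => e (f (e.symm (γ t))))).symm

end DirectionallyC1

section LogStretch

/-- The logarithmic weight `log (1 + 1 / r)`. -/
def logWeight (r : ℝ) : ℝ := Real.log (1 + r⁻¹)

theorem logWeight_nonneg {r : ℝ} (hr : 0 ≤ r) : 0 ≤ logWeight r :=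
  Real.log_nonneg (by have := inv_nonneg.2 hr; linarith)

theorem logWeight_anti {s r : ℝ} (hs : 0 < s) (h : s ≤ r) : logWeight r ≤ logWeight s := by
  have : r⁻¹ ≤ s⁻¹ := inv_anti₀ hs h
  have : 0 < r⁻¹ := inv_pos.2 (hs.trans_le h)
  exact Real.log_le_log (by linarith) (by linarith)

theorem mul_logWeight_mono {s r : ℝ} (hs : 0 ≤ s) (h : s ≤ r) :
    s * logWeight s ≤ r * logWeight r := by
  rcases hs.eq_or_lt with rfl | hs
  · simpa using mul_nonneg h (logWeight_nonneg h)
  have hr := hs.trans_le h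
  have hs' := inv_pos.2 hs
  have hb := rpow_one_add_le_one_add_mul_self (s := s⁻¹) (p := s / r) (by linarith)
    (by positivity) ((div_le_one hr).2 h)
  rw [show s / r * s⁻¹ = r⁻¹ by field_simp] at hb
  have hl := Real.log_le_log (by positivity) hb
  rw [Real.log_rpow (by positivity)] at hl
  calc s * logWeight s = r * (s / r * Real.log (1 + s⁻¹)) := by
        rw [logWeight]; field_simp
    _ ≤ r * logWeight r := mul_le_mul_of_nonneg_left hl hr.le

theorem mul_logWeight_le_one {r : ℝ} (hr : 0 ≤ r) : r * logWeight r ≤ 1 := by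
  rcases hr.eq_or_lt with rfl | hr
  · simp
  have h := Real.log_le_sub_one_of_pos (x := 1 + r⁻¹) (by positivity)
  calc r * logWeight r ≤ r * r⁻¹ := mul_le_mul_of_nonneg_left (by rw [logWeight]; linarith) hr.le
    _ = 1 := mul_inv_cancel₀ hr.ne'

theorem mul_logWeight_sub_le {s r : ℝ} (hs : 0 ≤ s) (h : s ≤ r) :
    s * (logWeight s - logWeight r) ≤ r - s := by
  rcases hs.eq_or_lt with rfl | hs
  · simpa using h
  have hr := hs.trans_le h
  have hq : (1 + s⁻¹) / (1 + r⁻¹) ≤ r / s := by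
    rw [div_le_div_iff₀ (by positivity) hs, add_mul, mul_add, inv_mul_cancel₀ hs.ne',
      mul_inv_cancel₀ hr.ne']
    linarith
  have hl := Real.log_le_sub_one_of_pos (x := (1 + s⁻¹) / (1 + r⁻¹)) (by positivity)
  rw [Real.log_div (by positivity) (by positivity)] at hl
  calc s * (logWeight s - logWeight r) ≤ s * (r / s - 1) :=
        mul_le_mul_of_nonneg_left (by rw [logWeight, logWeight]; linarith) hs.le
    _ = r - s := by field_simp

theorem tendsto_logWeight : Tendsto logWeight (𝓝[>] 0) atTop :=
  Real.tendsto_log_atTop.comp (tendsto_atTop_add_const_left _ _ tendsto_inv_nhdsGT_zero)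

theorem tendsto_mul_logWeight_sq :
    Tendsto (fun d => d * (2 + logWeight (d / 2)) ^ 2) (𝓝[>] 0) (𝓝 0) := by
  have h1 : Tendsto (fun u : ℝ => Real.log u ^ 2 / u) atTop (𝓝 0) := by
    simpa using (Real.isLittleO_pow_log_id_atTop (n := 2)).tendsto_div_nhds_zero
  have hu : Tendsto (fun d : ℝ => 1 + (d / 2)⁻¹) (𝓝[>] 0) atTop := by
    have : (fun d : ℝ => 1 + (d / 2)⁻¹) = fun d : ℝ => 1 + 2 * d⁻¹ := by
      funext d; rw [inv_div]; ring
    rw [this]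
    exact tendsto_atTop_add_const_left _ _
      (tendsto_inv_nhdsGT_zero.const_mul_atTop (by norm_num))
  have hd : Tendsto (fun d : ℝ => d) (𝓝[>] 0) (𝓝 0) := nhdsWithin_le_nhds
  have hlim : Tendsto (fun d : ℝ => 8 * d +
      2 * ((d + 2) * (logWeight (d / 2) ^ 2 / (1 + (d / 2)⁻¹)))) (𝓝[>] 0)
      (𝓝 (8 * 0 + 2 * ((0 + 2) * 0))) :=
    (hd.const_mul 8).add (((hd.add_const 2).mul (h1.comp hu)).const_mul 2)
  rw [show (8 * 0 + 2 * ((0 + 2) * 0) : ℝ) = 0 by norm_num] at hlim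
  refine squeeze_zero' ?_ ?_ hlim
  · filter_upwards [self_mem_nhdsWithin] with d (hd : 0 < d)
    positivity
  · filter_upwards [self_mem_nhdsWithin] with d (hd : 0 < d)
    have : (d + 2) * (logWeight (d / 2) ^ 2 / (1 + (d / 2)⁻¹)) = d * logWeight (d / 2) ^ 2 := by
      field_simp
    rw [this]
    nlinarith [mul_nonneg hd.le (sq_nonneg (logWeight (d / 2) - 2))]

variable {E : Type*} [NormedAddCommGroup E] [InnerProductSpace ℝ E]

/-- The radial map `x ↦ log (1 + 1 / ‖x‖) x`, whose derivative blows up logarithmically at the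
origin. -/
def logStretch (x : E) : E := logWeight ‖x‖ • x

theorem norm_logStretch (x : E) : ‖logStretch x‖ = ‖x‖ * logWeight ‖x‖ := by
  rw [logStretch, norm_smul, Real.norm_of_nonneg (logWeight_nonneg (norm_nonneg x)), mul_comm]

theorem norm_logStretch_le_one (x : E) : ‖logStretch x‖ ≤ 1 :=
  norm_logStretch x ▸ mul_logWeight_le_one (norm_nonneg x)

theorem inner_logStretch_sub_nonneg (x y : E) :
    0 ≤ inner ℝ (x - y) (logStretch x - logStretch y) := by
  have h : inner ℝ (x - y) (logStretch x - logStretch y) = logWeight ‖x‖ * ‖x‖ ^ 2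
      + logWeight ‖y‖ * ‖y‖ ^ 2 - (logWeight ‖x‖ + logWeight ‖y‖) * inner ℝ x y := by
    simp only [logStretch, inner_sub_left, inner_sub_right, real_inner_smul_right,
      real_inner_self_eq_norm_sq, real_inner_comm x y]
    ring
  have hx := logWeight_nonneg (norm_nonneg x)
  have hy := logWeight_nonneg (norm_nonneg y)
  have h1 := mul_le_mul_of_nonneg_left (real_inner_le_norm x y) (add_nonneg hx hy)
  have h2 : 0 ≤ (‖x‖ - ‖y‖) * (‖x‖ * logWeight ‖x‖ - ‖y‖ * logWeight ‖y‖) := by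
    rcases le_total ‖x‖ ‖y‖ with hxy | hxy
    · exact mul_nonneg_of_nonpos_of_nonpos (sub_nonpos.2 hxy)
        (sub_nonpos.2 (mul_logWeight_mono (norm_nonneg _) hxy))
    · exact mul_nonneg (sub_nonneg.2 hxy)
        (sub_nonneg.2 (mul_logWeight_mono (norm_nonneg _) hxy))
  rw [h]
  nlinarith

theorem norm_logStretch_sub_le (x y : E) :
    ‖logStretch x - logStretch y‖ ≤ ‖x - y‖ * (1 + logWeight (‖x - y‖ / 2)) := by
  wlog hyx : ‖y‖ ≤ ‖x‖ generalizing x y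
  · rw [norm_sub_rev, norm_sub_rev x y]
    exact this y x (le_of_not_ge hyx)
  rcases eq_or_ne x y with rfl | hne
  · simp
  have hd : 0 < ‖x - y‖ := norm_pos_iff.2 (sub_ne_zero.2 hne)
  have hdx : ‖x - y‖ / 2 ≤ ‖x‖ := by linarith [norm_sub_le x y]
  have hx0 : 0 < ‖x‖ := by linarith
  have hgx := logWeight_anti (by linarith) hdx
  have hg : ‖y‖ * |logWeight ‖x‖ - logWeight ‖y‖| ≤ ‖x‖ - ‖y‖ := by
    rcases (norm_nonneg y).eq_or_lt with h0 | h0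
    · rw [← h0]; simp
    · rw [abs_of_nonpos (sub_nonpos.2 (logWeight_anti h0 hyx)), neg_sub]
      exact mul_logWeight_sub_le h0.le hyx
  calc ‖logStretch x - logStretch y‖
      = ‖logWeight ‖x‖ • (x - y) + (logWeight ‖x‖ - logWeight ‖y‖) • y‖ := by
        congr 1; rw [logStretch, logStretch, smul_sub, sub_smul]; abel
    _ ≤ logWeight ‖x‖ * ‖x - y‖ + |logWeight ‖x‖ - logWeight ‖y‖| * ‖y‖ := by
        refine (norm_add_le _ _).trans_eq ?_
        rw [norm_smul, norm_smul, Real.norm_of_nonneg (logWeight_nonneg hx0.le), Real.norm_eq_abs]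
    _ ≤ ‖x - y‖ * (1 + logWeight (‖x - y‖ / 2)) := by
        have := norm_sub_norm_le x y
        nlinarith

theorem continuous_logStretch : Continuous (logStretch : E → E) := by
  refine continuous_iff_continuousAt.2 fun x => ?_
  rw [continuousAt_iff_punctured_nhds, tendsto_iff_norm_sub_tendsto_zero]
  refine squeeze_zero (fun _ => norm_nonneg _) (fun z => ?_)
    (tendsto_mul_logWeight_sq.comp (tendsto_norm_sub_self_nhdsNE x))
  refine (norm_logStretch_sub_le z x).trans
    (mul_le_mul_of_nonneg_left ?_ (norm_nonneg _))
  nlinarith [logWeight_nonneg (div_nonneg (norm_nonneg (z - x)) zero_le_two)]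

/-- The radial correction in the derivative of `logStretch`. -/
def radialPart (x : E) : E →L[ℝ] E :=
  (‖x‖ ^ 2 * (1 + ‖x‖))⁻¹ • (innerSL ℝ x).smulRight x

theorem norm_radialPart_le_one (x : E) : ‖radialPart x‖ ≤ 1 := by
  rw [radialPart, norm_smul, ContinuousLinearMap.norm_smulRight_apply, innerSL_apply_norm,
    Real.norm_of_nonneg (by positivity)]
  rcases (norm_nonneg x).eq_or_lt with h0 | h0
  · rw [← h0]; simp
  · rw [inv_mul_le_iff₀ (by positivity)]
    nlinarith [pow_pos h0 3]

theorem continuousAt_radialPart {x : E} (hx : x ≠ 0) : ContinuousAt radialPart x := by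
  have hx' : 0 < ‖x‖ := norm_pos_iff.2 hx
  have hc : ContinuousAt (fun x : E => (‖x‖ ^ 2 * (1 + ‖x‖))⁻¹) x :=
    ContinuousAt.inv₀ (by fun_prop) (by positivity)
  refine hc.smul ?_
  have : Continuous fun x : E => (innerSL ℝ x).smulRight x := by
    have := (ContinuousLinearMap.smulRightL ℝ E E).isBoundedBilinearMap.continuous
    exact this.comp ((innerSL ℝ).continuous.prodMk continuous_id)
  exact this.continuousAt

theorem hasFDerivAt_logStretch {x : E} (hx : x ≠ 0) :
    HasFDerivAt logStretch (logWeight ‖x‖ • ContinuousLinearMap.id ℝ E - radialPart x) x := by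
  have hx' : 0 < ‖x‖ := norm_pos_iff.2 hx
  have hn : HasFDerivAt (fun z : E => ‖z‖) (‖x‖⁻¹ • innerSL ℝ x) x := by
    have h2 : HasFDerivAt (fun z : E => ‖z‖ ^ 2) (2 • innerSL ℝ x) x :=
      (hasStrictFDerivAt_norm_sq x).hasFDerivAt
    have := h2.sqrt (by positivity)
    simp only [Real.sqrt_sq (norm_nonneg _)] at this
    refine this.congr_fderiv ?_
    ext v
    simp
    field_simp
  have hw : HasDerivAt logWeight (-(‖x‖ * (1 + ‖x‖))⁻¹) ‖x‖ := by
    have := ((hasDerivAt_inv hx'.ne').const_add 1).log (by positivity)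
    refine this.congr_deriv ?_
    field_simp
    ring
  refine ((hw.comp_hasFDerivAt x hn).smul (hasFDerivAt_id x)).congr_fderiv ?_
  ext v
  simp [radialPart, smul_smul, sub_eq_add_neg]
  congr 1
  field_simp

end LogStretch

section StretchSum

variable {E : Type*} [NormedAddCommGroup E] {p : ℕ → E} {w : ℕ → ℝ}

/-- The scalar part of the derivative of `stretchSum p w`. -/
def stretchFactor (p : ℕ → E) (w : ℕ → ℝ) (x : E) : ℝ := 1 + ∑' n, w n * logWeight ‖x - p n‖

theorem exists_ball_dist_ge (hK : IsClosed (Set.range p)) {x : E} (hx : x ∉ Set.range p) :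
    ∃ δ > 0, ∀ z ∈ Metric.ball x δ, ∀ n, δ ≤ ‖z - p n‖ := by
  obtain ⟨ε, hε, h⟩ := Metric.isOpen_iff.1 hK.isOpen_compl x hx
  refine ⟨ε / 2, by positivity, fun z hz n => ?_⟩
  have h1 : ε ≤ dist (p n) x := not_lt.1 fun h1 => h h1 ⟨n, rfl⟩
  have h2 := dist_triangle (p n) z x
  rw [Metric.mem_ball] at hz
  rw [← dist_eq_norm, dist_comm]
  linarith

theorem norm_mul_logWeight_le (hw : ∀ n, 0 < w n) {δ : ℝ} (hδ : 0 < δ) {x : E} {n : ℕ}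
    (h : δ ≤ ‖x - p n‖) : ‖w n * logWeight ‖x - p n‖‖ ≤ w n * logWeight δ := by
  rw [norm_mul, Real.norm_of_nonneg (hw n).le,
    Real.norm_of_nonneg (logWeight_nonneg (norm_nonneg _))]
  exact mul_le_mul_of_nonneg_left (logWeight_anti hδ h) (hw n).le

theorem one_le_stretchFactor (hw : ∀ n, 0 < w n) (x : E) : 1 ≤ stretchFactor p w x :=
  le_add_of_nonneg_right
    (tsum_nonneg fun n => mul_nonneg (hw n).le (logWeight_nonneg (norm_nonneg _)))

theorem continuousAt_stretchFactor (hw : ∀ n, 0 < w n) (hs : Summable w)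
    (hK : IsClosed (Set.range p)) {x : E} (hx : x ∉ Set.range p) :
    ContinuousAt (stretchFactor p w) x := by
  obtain ⟨δ, hδ, h⟩ := exists_ball_dist_ge hK hx
  have hc : ContinuousOn (fun x => ∑' n, w n * logWeight ‖x - p n‖) (Metric.ball x δ) := by
    refine continuousOn_tsum (fun n => ?_) (hs.mul_right (logWeight δ))
      fun n z hz => norm_mul_logWeight_le hw hδ (h z hz n)
    unfold logWeight
    have hpos : ∀ z ∈ Metric.ball x δ, 0 < ‖z - p n‖ := fun z hz => hδ.trans_le (h z hz n)
    refine continuousOn_const.mul (ContinuousOn.log (continuousOn_const.add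
      (ContinuousOn.inv₀ (by fun_prop) fun z hz => (hpos z hz).ne')) fun z hz => ?_)
    have := hpos z hz
    positivity
  exact continuousAt_const.add (hc.continuousAt (Metric.ball_mem_nhds x hδ))

theorem one_add_le_stretchFactor (hw : ∀ n, 0 < w n) (hs : Summable w)
    (hK : IsClosed (Set.range p)) {x : E} (hx : x ∉ Set.range p) (m : ℕ) :
    1 + w m * logWeight ‖x - p m‖ ≤ stretchFactor p w x := by
  obtain ⟨δ, hδ, h⟩ := exists_ball_dist_ge hK hx
  have hsum : Summable fun n => w n * logWeight ‖x - p n‖ :=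
    Summable.of_norm_bounded (hs.mul_right (logWeight δ))
      fun n => norm_mul_logWeight_le hw hδ (h x (Metric.mem_ball_self hδ) n)
  have := hsum.le_tsum m fun n _ => mul_nonneg (hw n).le (logWeight_nonneg (norm_nonneg _))
  rw [stretchFactor]
  linarith

variable [InnerProductSpace ℝ E]

/-- A strongly monotone map with sufficiently good modulus of continuity is surjective. -/
theorem surjective_of_strongly_monotone [ProperSpace E] {F : E → E} (hF : Continuous F)
    (hmono : ∀ x y, ‖x - y‖ ^ 2 ≤ inner ℝ (x - y) (F x - F y)) {ω : ℝ → ℝ}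
    (hω : ∀ x y, ‖F x - F y‖ ≤ ‖x - y‖ * ω ‖x - y‖)
    (hlim : Tendsto (fun d => d * ω d ^ 2) (𝓝[>] 0) (𝓝 0)) : Function.Surjective F := by
  intro y
  have hexp : ∀ x, ‖x‖ ≤ ‖F x - F 0‖ := fun x => by
    have h1 := hmono x 0
    have h2 := real_inner_le_norm (x - 0) (F x - F 0)
    rw [sub_zero] at h1 h2
    rcases (norm_nonneg x).eq_or_lt with h0 | h0
    · rw [← h0]; exact norm_nonneg _
    · exact le_of_mul_le_mul_left (by nlinarith) h0
  have htend : Tendsto (fun x => ‖F x - y‖) (cocompact E) atTop := by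
    refine tendsto_atTop_mono (fun x => ?_)
      (tendsto_atTop_add_const_right _ (-‖F 0 - y‖) (tendsto_norm_cocompact_atTop (E := E)))
    have := norm_sub_le (F x - y) (F 0 - y)
    rw [sub_sub_sub_cancel_right] at this
    linarith [hexp x]
  obtain ⟨x₀, hx₀⟩ := (hF.sub continuous_const).norm.exists_forall_le htend
  refine ⟨x₀, ?_⟩
  by_contra hne
  set v := y - F x₀ with hv
  have hv0 : 0 < ‖v‖ := norm_pos_iff.2 (sub_ne_zero.2 (Ne.symm hne))
  have hlow : ∀ d > 0, 2 * ‖v‖ ≤ d * ω d ^ 2 := fun d hd => by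
    set t := d / ‖v‖ with ht_def
    have ht : 0 < t := div_pos hd hv0
    have htv : ‖t • v‖ = d := by
      rw [norm_smul, Real.norm_of_nonneg ht.le, ht_def, div_mul_cancel₀ _ hv0.ne']
    have h1 := hmono (x₀ + t • v) x₀
    have h2 := hω (x₀ + t • v) x₀
    rw [add_sub_cancel_left, htv] at h1 h2
    have h3 : ‖v‖ ≤ ‖(F (x₀ + t • v) - F x₀) - v‖ := by
      have : ‖F x₀ - y‖ ≤ ‖F (x₀ + t • v) - y‖ := hx₀ (x₀ + t • v)
      rw [norm_sub_rev (F x₀), ← hv] at this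
      rwa [hv, sub_sub_sub_cancel_right]
    have h4 := norm_sub_sq_real (F (x₀ + t • v) - F x₀) v
    rw [real_inner_smul_left, real_inner_comm] at h1
    have h5 : ‖v‖ ^ 2 ≤ ‖(F (x₀ + t • v) - F x₀) - v‖ ^ 2 := by gcongr
    have h6 : ‖F (x₀ + t • v) - F x₀‖ ^ 2 ≤ (d * ω d) ^ 2 := by gcongr
    have h7 : d * ‖v‖ ≤ inner ℝ (F (x₀ + t • v) - F x₀) v := by
      refine le_of_mul_le_mul_left ?_ ht
      calc t * (d * ‖v‖) = d ^ 2 := by rw [ht_def]; field_simp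
        _ ≤ _ := h1
    refine le_of_mul_le_mul_left ?_ hd
    nlinarith
  obtain ⟨d, hd, hd'⟩ := ((hlim.eventually (gt_mem_nhds (by positivity : 0 < 2 * ‖v‖))).and
    (self_mem_nhdsWithin : Set.Ioi (0 : ℝ) ∈ 𝓝[>] 0)).exists
  exact absurd (hlow d hd') (not_le.2 hd)

/-- The identity plus a weighted sum of logarithmic stretches centred at the points `p n`. -/
def stretchSum (p : ℕ → E) (w : ℕ → ℝ) (x : E) : E := x + ∑' n, w n • logStretch (x - p n)

theorem hasSum_stretchSum [CompleteSpace E] (hw : ∀ n, 0 < w n) (hs : Summable w) (x : E) :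
    HasSum (fun n => w n • logStretch (x - p n)) (stretchSum p w x - x) := by
  rw [stretchSum, add_sub_cancel_left]
  refine (Summable.of_norm_bounded hs fun n => ?_).hasSum
  rw [norm_smul, Real.norm_of_nonneg (hw n).le]
  exact mul_le_of_le_one_right (hw n).le (norm_logStretch_le_one _)

theorem continuous_stretchSum [CompleteSpace E] (hw : ∀ n, 0 < w n) (hs : Summable w) :
    Continuous (stretchSum p w) := by
  refine continuous_id.add (continuous_tsum (fun n => ?_) hs fun n x => ?_)
  · exact (continuous_logStretch.comp (continuous_id.sub continuous_const)).const_smul _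
  · rw [norm_smul, Real.norm_of_nonneg (hw n).le]
    exact mul_le_of_le_one_right (hw n).le (norm_logStretch_le_one _)

theorem inner_stretchSum_sub_ge [CompleteSpace E] (hw : ∀ n, 0 < w n) (hs : Summable w) (m : ℕ)
    (x y : E) :
    ‖x - y‖ ^ 2 + w m * inner ℝ (x - y) (logStretch (x - p m) - logStretch (y - p m)) ≤
      inner ℝ (x - y) (stretchSum p w x - stretchSum p w y) := by
  have h1 := ((hasSum_stretchSum (p := p) hw hs x).sub (hasSum_stretchSum (p := p) hw hs y)).mapL
    (innerSL ℝ (x - y))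
  simp only [← smul_sub, map_smul, innerSL_apply_apply, smul_eq_mul] at h1
  have h2 := le_hasSum h1 m fun n _ => mul_nonneg (hw n).le (by
    simpa using inner_logStretch_sub_nonneg (x - p n) (y - p n))
  have h3 : stretchSum p w x - x - (stretchSum p w y - y) =
      (stretchSum p w x - stretchSum p w y) - (x - y) := by abel
  rw [h3, inner_sub_right _ _ (x - y), real_inner_self_eq_norm_sq] at h2
  linarith

theorem inner_stretchSum_sub_ge_norm_sq [CompleteSpace E] (hw : ∀ n, 0 < w n) (hs : Summable w)
    (x y : E) :
    ‖x - y‖ ^ 2 ≤ inner ℝ (x - y) (stretchSum p w x - stretchSum p w y) := by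
  have h1 := inner_stretchSum_sub_ge (p := p) hw hs 0 x y
  have h2 := mul_nonneg (hw 0).le (inner_logStretch_sub_nonneg (x - p 0) (y - p 0))
  rw [sub_sub_sub_cancel_right] at h2
  linarith

theorem norm_stretchSum_sub_le [CompleteSpace E] (hw : ∀ n, 0 < w n) (hs : Summable w)
    (hs1 : ∑' n, w n < 1) (x y : E) :
    ‖stretchSum p w x - stretchSum p w y‖ ≤ ‖x - y‖ * (2 + logWeight (‖x - y‖ / 2)) := by
  set D := ‖x - y‖ * (1 + logWeight (‖x - y‖ / 2)) with hD
  have hD0 : 0 ≤ D := mul_nonneg (norm_nonneg _)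
    (by linarith [logWeight_nonneg (div_nonneg (norm_nonneg (x - y)) zero_le_two)])
  have h1 := (hasSum_stretchSum (p := p) hw hs x).sub (hasSum_stretchSum (p := p) hw hs y)
  have h2 : ‖stretchSum p w x - x - (stretchSum p w y - y)‖ ≤ (∑' n, w n) * D := by
    rw [← h1.tsum_eq]
    refine tsum_of_norm_bounded (hs.hasSum.mul_right D) fun n => ?_
    rw [← smul_sub, norm_smul, Real.norm_of_nonneg (hw n).le]
    refine mul_le_mul_of_nonneg_left ?_ (hw n).le
    simpa using norm_logStretch_sub_le (x - p n) (y - p n)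
  have h3 : stretchSum p w x - stretchSum p w y =
      (stretchSum p w x - x - (stretchSum p w y - y)) + (x - y) := by abel
  rw [h3]
  refine (norm_add_le _ _).trans ?_
  nlinarith

theorem norm_sub_le_norm_stretchSum_sub [CompleteSpace E] (hw : ∀ n, 0 < w n) (hs : Summable w)
    (x y : E) : ‖x - y‖ ≤ ‖stretchSum p w x - stretchSum p w y‖ := by
  rcases (norm_nonneg (x - y)).eq_or_lt with h0 | h0
  · rw [← h0]; exact norm_nonneg _
  · have h1 := inner_stretchSum_sub_ge_norm_sq (p := p) hw hs x y
    have h2 := real_inner_le_norm (x - y) (stretchSum p w x - stretchSum p w y)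
    exact le_of_mul_le_mul_left (by nlinarith) h0

theorem isHomeomorph_stretchSum [ProperSpace E] [CompleteSpace E] (hw : ∀ n, 0 < w n)
    (hs : Summable w) (hs1 : ∑' n, w n < 1) : IsHomeomorph (stretchSum p w) := by
  have hanti : AntilipschitzWith 1 (stretchSum p w) := AntilipschitzWith.of_le_mul_dist
    fun x y => by
      simpa [dist_eq_norm] using norm_sub_le_norm_stretchSum_sub hw hs x y
  have hc := continuous_stretchSum (p := p) hw hs
  rw [isHomeomorph_iff_isEmbedding_surjective]
  exact ⟨⟨hanti.isInducing hc, hanti.injective⟩,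
    surjective_of_strongly_monotone hc (inner_stretchSum_sub_ge_norm_sq hw hs)
      (norm_stretchSum_sub_le hw hs hs1) tendsto_mul_logWeight_sq⟩

theorem not_differentiableAt_stretchSum [CompleteSpace E] [Nontrivial E] (hw : ∀ n, 0 < w n)
    (hs : Summable w) (m : ℕ) : ¬ DifferentiableAt ℝ (stretchSum p w) (p m) := by
  intro h
  obtain ⟨C, hC⟩ := h.hasFDerivAt.isBigO_sub.bound
  have htop : Tendsto (fun z => w m * logWeight ‖z - p m‖) (𝓝[≠] p m) atTop :=
    (tendsto_logWeight.comp (tendsto_norm_sub_self_nhdsNE (p m))).const_mul_atTop (hw m)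
  obtain ⟨z, ⟨hz1, hz2⟩, hz3⟩ := (((hC.filter_mono nhdsWithin_le_nhds).and
    (htop.eventually_ge_atTop C)).and (self_mem_nhdsWithin : {p m}ᶜ ∈ 𝓝[≠] p m)).exists
  have hd : 0 < ‖z - p m‖ := norm_pos_iff.2 (sub_ne_zero.2 hz3)
  have h1 := inner_stretchSum_sub_ge (p := p) hw hs m z (p m)
  have h2 := real_inner_le_norm (z - p m) (stretchSum p w z - stretchSum p w (p m))
  rw [sub_self, show logStretch (0 : E) = 0 by simp [logStretch], sub_zero, logStretch,
    real_inner_smul_right, real_inner_self_eq_norm_sq] at h1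
  have h3 : ‖z - p m‖ * ‖stretchSum p w z - stretchSum p w (p m)‖ ≤ ‖z - p m‖ * (C * ‖z - p m‖) :=
    mul_le_mul_of_nonneg_left hz1 hd.le
  have h4 : C * ‖z - p m‖ ^ 2 ≤ (w m * logWeight ‖z - p m‖) * ‖z - p m‖ ^ 2 := by gcongr
  nlinarith [pow_pos hd 2]

/-- The bounded part of the derivative of `stretchSum p w`. -/
def stretchDefect (p : ℕ → E) (w : ℕ → ℝ) (x : E) : E →L[ℝ] E := ∑' n, w n • radialPart (x - p n)

theorem norm_smul_radialPart_le (hw : ∀ n, 0 < w n) (x : E) (n : ℕ) :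
    ‖w n • radialPart (x - p n)‖ ≤ w n := by
  rw [norm_smul, Real.norm_of_nonneg (hw n).le]
  exact mul_le_of_le_one_right (hw n).le (norm_radialPart_le_one _)

theorem norm_stretchDefect_le (hw : ∀ n, 0 < w n) (hs : Summable w) (x : E) :
    ‖stretchDefect p w x‖ ≤ ∑' n, w n :=
  tsum_of_norm_bounded hs.hasSum fun n => norm_smul_radialPart_le hw x n

theorem continuousAt_stretchDefect [CompleteSpace E] (hw : ∀ n, 0 < w n) (hs : Summable w)
    (hK : IsClosed (Set.range p)) {x : E} (hx : x ∉ Set.range p) :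
    ContinuousAt (stretchDefect p w) x := by
  obtain ⟨δ, hδ, h⟩ := exists_ball_dist_ge hK hx
  have hc : ContinuousOn (stretchDefect p w) (Metric.ball x δ) := by
    refine continuousOn_tsum (fun n z hz => ?_) hs fun n z _ => norm_smul_radialPart_le hw z n
    have hne : z - p n ≠ 0 := norm_pos_iff.1 (hδ.trans_le (h z hz n))
    exact (((continuousAt_radialPart hne).comp (f := fun z => z - p n)
      (by fun_prop)).const_smul (w n)).continuousWithinAt
  exact hc.continuousAt (Metric.ball_mem_nhds x hδ)

theorem hasFDerivAt_stretchSum [CompleteSpace E] (hw : ∀ n, 0 < w n) (hs : Summable w)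
    (hK : IsClosed (Set.range p)) {x : E} (hx : x ∉ Set.range p) :
    HasFDerivAt (stretchSum p w) (stretchFactor p w x • 1 - stretchDefect p w x) x := by
  obtain ⟨δ, hδ, h⟩ := exists_ball_dist_ge hK hx
  have hxball := Metric.mem_ball_self (x := x) hδ
  have hd := hasFDerivAt_tsum_of_isPreconnected
    (f := fun n x => w n • logStretch (x - p n)) (x := x)
    (f' := fun n x => (w n * logWeight ‖x - p n‖) • (1 : E →L[ℝ] E) - w n • radialPart (x - p n))
    ((hs.mul_right (logWeight δ)).add hs) Metric.isOpen_ball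
    (convex_ball x δ).isPreconnected (fun n z hz => ?_) (fun n z hz => ?_) hxball
    (hasSum_stretchSum hw hs x).summable hxball
  · have hs1 : Summable fun n => w n * logWeight ‖x - p n‖ :=
      Summable.of_norm_bounded (hs.mul_right (logWeight δ))
        fun n => norm_mul_logWeight_le hw hδ (h x hxball n)
    have hs2 : Summable fun n => w n • radialPart (x - p n) :=
      Summable.of_norm_bounded hs fun n => norm_smul_radialPart_le hw x n
    rw [(hs1.smul_const (1 : E →L[ℝ] E)).tsum_sub hs2, hs1.tsum_smul_const] at hd
    refine ((hasFDerivAt_id x).add hd).congr_fderiv ?_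
    rw [stretchFactor, stretchDefect, add_smul, one_smul, add_sub_assoc]
    rfl
  · have hne : z - p n ≠ 0 := norm_pos_iff.1 (hδ.trans_le (h z hz n))
    have := ((hasFDerivAt_logStretch hne).comp z ((hasFDerivAt_id z).sub_const (p n))).const_smul
      (w n)
    refine this.congr_fderiv ?_
    ext v
    simp [smul_sub, mul_smul]
  · refine (norm_sub_le _ _).trans (add_le_add ?_ (norm_smul_radialPart_le hw z n))
    rw [norm_smul]
    exact (mul_le_of_le_one_right (norm_nonneg _) ContinuousLinearMap.norm_id_le).trans
      (norm_mul_logWeight_le hw hδ (h z hz n))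

theorem isDirectionallyC1_stretchSum [CompleteSpace E] (hw : ∀ n, 0 < w n) (hs : Summable w)
    (hs1 : ∑' n, w n < 1) (hK : IsClosed (Set.range p)) : IsDirectionallyC1 (stretchSum p w) := by
  classical
  set κ : E → ℝ := fun x => if x ∈ Set.range p then 0 else (stretchFactor p w x)⁻¹ with hκ
  have hκ0 : ∀ x ∈ Set.range p, κ x = 0 := fun x hx => if_pos hx
  have hκ1 : ∀ x ∉ Set.range p, κ x = (stretchFactor p w x)⁻¹ := fun x hx => if_neg hx
  have hpos : ∀ x, 0 < stretchFactor p w x := fun x =>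
    one_pos.trans_le (one_le_stretchFactor hw x)
  have hκnn : ∀ x, 0 ≤ κ x := fun x => by
    by_cases hx : x ∈ Set.range p
    · exact (hκ0 x hx).ge
    · exact hκ1 x hx ▸ (inv_pos.2 (hpos x)).le
  have hκle : ∀ x, κ x ≤ 1 := fun x => by
    by_cases hx : x ∈ Set.range p
    · exact hκ0 x hx ▸ zero_le_one
    · exact hκ1 x hx ▸ inv_le_one_of_one_le₀ (one_le_stretchFactor hw x)
  have hnorm : ∀ x, ‖κ x • stretchDefect p w x‖ ≤ κ x * ∑' n, w n := fun x => by
    rw [norm_smul, Real.norm_of_nonneg (hκnn x)]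
    exact mul_le_mul_of_nonneg_left (norm_stretchDefect_le hw hs x) (hκnn x)
  have hw0 : 0 ≤ ∑' n, w n := tsum_nonneg fun n => (hw n).le
  refine ⟨Set.range p, fun x => 1 - κ x • stretchDefect p w x, Set.countable_range p,
    continuous_const.sub (continuous_iff_continuousAt.2 fun x => ?_), fun x => ?_, fun x hx => ?_⟩
  · by_cases hx : x ∈ Set.range p
    · obtain ⟨m, rfl⟩ := hx
      rw [continuousAt_iff_punctured_nhds, hκ0 _ ⟨m, rfl⟩, zero_smul]
      have htop : Tendsto (fun z => 1 + w m * logWeight ‖z - p m‖) (𝓝[≠] p m) atTop :=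
        tendsto_atTop_add_const_left _ _
          ((tendsto_logWeight.comp (tendsto_norm_sub_self_nhdsNE (p m))).const_mul_atTop (hw m))
      refine squeeze_zero_norm (fun z => ?_) htop.inv_tendsto_atTop
      have hpos' : 0 < 1 + w m * logWeight ‖z - p m‖ := by
        have := mul_nonneg (hw m).le (logWeight_nonneg (norm_nonneg (z - p m)))
        linarith
      refine ((hnorm z).trans (mul_le_of_le_one_right (hκnn z) hs1.le)).trans ?_
      by_cases hz : z ∈ Set.range p
      · rw [hκ0 z hz]
        exact (inv_pos.2 hpos').le
      · rw [hκ1 z hz]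
        exact inv_anti₀ hpos' (one_add_le_stretchFactor hw hs hK hz m)
    · have hev : κ =ᶠ[𝓝 x] fun z => (stretchFactor p w z)⁻¹ :=
        Filter.eventuallyEq_of_mem (hK.isOpen_compl.mem_nhds hx) hκ1
      exact (((continuousAt_stretchFactor hw hs hK hx).inv₀ (hpos x).ne').congr hev.symm).smul
        (continuousAt_stretchDefect hw hs hK hx)
  · exact isUnit_one_sub_of_norm_lt_one (((hnorm x).trans
      (mul_le_of_le_one_left hw0 (hκle x))).trans_lt hs1)
  · refine ⟨_, hpos x, (hasFDerivAt_stretchSum hw hs hK hx).congr_fderiv ?_⟩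
    simp only [hκ1 x hx]
    rw [smul_sub, smul_smul, mul_inv_cancel₀ (hpos x).ne', one_smul]

end StretchSum

/-- The origin of `ℂ` followed by the points `2⁻ⁿ`. -/
def dyadicPoint : ℕ → ℂ
  | 0 => 0
  | n + 1 => ((2⁻¹ : ℝ) ^ n : ℝ)

theorem isClosed_range_dyadicPoint : IsClosed (Set.range dyadicPoint) := by
  have h : Tendsto (fun n : ℕ => (((2⁻¹ : ℝ) ^ n : ℝ) : ℂ)) atTop (𝓝 0) := by
    have := tendsto_pow_atTop_nhds_zero_of_lt_one (r := (2⁻¹ : ℝ)) (by norm_num) (by norm_num)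
    simpa only [Complex.ofReal_zero, Function.comp_def] using
      (Complex.continuous_ofReal.tendsto 0).comp this
  have hrange : Set.range dyadicPoint =
      insert 0 (Set.range fun n : ℕ => (((2⁻¹ : ℝ) ^ n : ℝ) : ℂ)) := by
    ext z
    constructor
    · rintro ⟨_ | n, rfl⟩
      · exact Set.mem_insert _ _
      · exact Set.mem_insert_of_mem _ ⟨n, rfl⟩
    · rintro (rfl | ⟨n, rfl⟩)
      · exact ⟨0, rfl⟩
      · exact ⟨n + 1, rfl⟩
  rw [hrange]
  exact h.isCompact_insert_range.isClosed

/-- There is an element of `Homeo¹(ℝ²)` that is not differentiable at any of the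
points `(2⁻ⁿ, 0)`, `n ∈ ℕ`. -/
theorem exists_countably_many_nondiff_points :
    ∃ f : Plane ≃ₜ Plane, InHomeo1 f ∧
      ∀ n : ℕ, ¬ DifferentiableAt ℝ (⇑f) (((2:ℝ) ^ (-(n:ℤ)), 0) : Plane) := by
  set w : ℕ → ℝ := fun n => 1 / 4 * (1 / 2) ^ n
  have hw : ∀ n, 0 < w n := fun n => by positivity
  have hs : HasSum w (1 / 4 * 2) := hasSum_geometric_two.mul_left _
  have hs1 : ∑' n, w n < 1 := by rw [hs.tsum_eq]; norm_num
  let F : ℂ ≃ₜ ℂ := (isHomeomorph_stretchSum (p := dyadicPoint) hw hs.summable hs1).homeomorph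
  have hF : IsDirectionallyC1 F :=
    isDirectionallyC1_stretchSum hw hs.summable hs1 isClosed_range_dyadicPoint
  let e : ℂ ≃L[ℝ] Plane := Complex.equivRealProdCLM
  let f : Plane ≃ₜ Plane := (e.symm.toHomeomorph.trans F).trans e.toHomeomorph
  refine ⟨f, ⟨hF.mapsC1 e, hF.symm.mapsC1 e⟩, fun n hn => ?_⟩
  have hp : ((2 : ℝ) ^ (-(n : ℤ)), (0 : ℝ)) = e (dyadicPoint (n + 1)) := by
    rw [zpow_neg, zpow_natCast, ← inv_pow]
    exact Prod.ext (Complex.ofReal_re ((2⁻¹ : ℝ) ^ n)).symm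
      (Complex.ofReal_im ((2⁻¹ : ℝ) ^ n)).symm
  refine not_differentiableAt_stretchSum (p := dyadicPoint) hw hs.summable (n + 1) ?_
  rw [hp] at hn
  have h := e.symm.differentiableAt.comp _ (hn.comp (dyadicPoint (n + 1)) e.differentiableAt)
  have hEq : e.symm ∘ (f ∘ e) = stretchSum dyadicPoint w := by
    funext z
    simp [f]
    rfl
  rwa [hEq] at h
end
end

section
/- There exists a homeomorphism f of ℝ² such that f maps every simple closed C¹ curve to a simple closed C¹ curve and f induces a homeomorphism of projective tangent spaces at every point of ℝ², yet there exists a simple closed C¹ curve Γ such that f⁻¹(Γ) is not a simple closed C¹ curve; in particular f ∉ Homeo¹(ℝ²). -/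
open Filter Topology

noncomputable section

/-- The vertical displacement of `shear`; its vertical slope tends to `1` along the horizontal
axis towards the origin. -/
def perturb (p : Plane) : ℝ := p.1 ^ 4 * p.2 / (p.1 ^ 4 + p.1 ^ 6 + p.2 ^ 2)

/-- The partial derivative of `perturb` in the first variable. -/
def perturbFst (p : Plane) : ℝ :=
  (4 * p.1 ^ 3 * p.2 ^ 3 - 2 * p.1 ^ 9 * p.2) / (p.1 ^ 4 + p.1 ^ 6 + p.2 ^ 2) ^ 2

/-- The partial derivative of `perturb` in the second variable. -/
def perturbSnd (p : Plane) : ℝ :=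
  p.1 ^ 4 * (p.1 ^ 4 + p.1 ^ 6 - p.2 ^ 2) / (p.1 ^ 4 + p.1 ^ 6 + p.2 ^ 2) ^ 2

theorem denom_pos {p : Plane} (hp : p ≠ 0) : 0 < p.1 ^ 4 + p.1 ^ 6 + p.2 ^ 2 := by
  by_cases h : p.1 = 0
  · have : p.2 ≠ 0 := fun h' => hp (Prod.ext h h')
    positivity
  · positivity

theorem perturb_zero : perturb 0 = 0 := by simp [perturb]

theorem perturbFst_zero : perturbFst 0 = 0 := by simp [perturbFst]

theorem perturbSnd_zero : perturbSnd 0 = 0 := by simp [perturbSnd]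

theorem sq_mul_abs_le (x y : ℝ) : x ^ 2 * |y| ≤ (x ^ 4 + x ^ 6 + y ^ 2) / 2 := by
  have h1 : 0 ≤ x ^ 6 := by positivity
  nlinarith [sq_nonneg (x ^ 2 - |y|), sq_abs y]

theorem abs_perturb_le (p : Plane) : |perturb p| ≤ p.1 ^ 2 := by
  have hQ : 0 ≤ p.1 ^ 4 + p.1 ^ 6 + p.2 ^ 2 := by positivity
  rw [perturb, abs_div, abs_of_nonneg hQ]
  refine div_le_of_le_mul₀ hQ (by positivity) ?_
  rw [abs_mul, abs_of_nonneg (by positivity : (0 : ℝ) ≤ p.1 ^ 4)]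
  nlinarith [mul_le_mul_of_nonneg_left (sq_mul_abs_le p.1 p.2) (sq_nonneg p.1),
    mul_nonneg (sq_nonneg p.1) hQ]

theorem abs_perturbFst_le (p : Plane) : |perturbFst p| ≤ 2 * |p.1| + |p.1| ^ 3 := by
  set Q := p.1 ^ 4 + p.1 ^ 6 + p.2 ^ 2 with hQdef
  have h6 : 0 ≤ p.1 ^ 6 := by positivity
  have h4 : 0 ≤ p.1 ^ 4 := by positivity
  have h2 : 0 ≤ p.2 ^ 2 := by positivity
  have hQ : 0 ≤ Q := by positivity
  rw [perturbFst, abs_div, ← hQdef, abs_of_nonneg (by positivity : 0 ≤ Q ^ 2)]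
  refine div_le_of_le_mul₀ (by positivity) (by positivity) ?_
  have hs : p.1 ^ 2 * |p.2| ≤ Q / 2 := sq_mul_abs_le p.1 p.2
  have e1 : |4 * p.1 ^ 3 * p.2 ^ 3| = 4 * |p.1| * ((p.1 ^ 2 * |p.2|) * p.2 ^ 2) := by
    rw [← sq_abs p.1, ← sq_abs p.2]
    simp only [abs_mul, abs_pow, Nat.abs_ofNat]
    ring
  have e2 : |2 * p.1 ^ 9 * p.2| = 2 * |p.1| ^ 3 * ((p.1 ^ 2 * |p.2|) * p.1 ^ 4) := by
    have : p.1 ^ 4 = |p.1| ^ 4 := by rw [pow_abs, abs_of_nonneg h4]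
    rw [this, ← sq_abs p.1]
    simp only [abs_mul, abs_pow, Nat.abs_ofNat]
    ring
  have b1 : (p.1 ^ 2 * |p.2|) * p.2 ^ 2 ≤ Q / 2 * Q := by
    gcongr
    linarith
  have b2 : (p.1 ^ 2 * |p.2|) * p.1 ^ 4 ≤ Q / 2 * Q := by
    gcongr
    linarith
  calc |4 * p.1 ^ 3 * p.2 ^ 3 - 2 * p.1 ^ 9 * p.2|
      ≤ |4 * p.1 ^ 3 * p.2 ^ 3| + |2 * p.1 ^ 9 * p.2| := abs_sub _ _
    _ ≤ 4 * |p.1| * (Q / 2 * Q) + 2 * |p.1| ^ 3 * (Q / 2 * Q) := by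
      rw [e1, e2]
      gcongr
    _ = _ := by ring

theorem abs_perturbSnd_le (p : Plane) :
    |perturbSnd p| ≤ p.1 ^ 4 / (p.1 ^ 4 + p.1 ^ 6 + p.2 ^ 2) := by
  rcases eq_or_ne p 0 with rfl | hp
  · simp [perturbSnd]
  have hQ := denom_pos hp
  have h4 : 0 ≤ p.1 ^ 4 := by positivity
  have h46 : 0 ≤ p.1 ^ 4 + p.1 ^ 6 := by positivity
  rw [perturbSnd, abs_div, abs_of_nonneg (by positivity : 0 ≤ (p.1 ^ 4 + p.1 ^ 6 + p.2 ^ 2) ^ 2),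
    div_le_div_iff₀ (by positivity) hQ, abs_mul, abs_of_nonneg h4]
  have : |p.1 ^ 4 + p.1 ^ 6 - p.2 ^ 2| ≤ p.1 ^ 4 + p.1 ^ 6 + p.2 ^ 2 :=
    abs_le.2 ⟨by nlinarith [sq_nonneg p.2], by nlinarith [sq_nonneg p.2]⟩
  calc p.1 ^ 4 * |p.1 ^ 4 + p.1 ^ 6 - p.2 ^ 2| * (p.1 ^ 4 + p.1 ^ 6 + p.2 ^ 2)
      ≤ p.1 ^ 4 * (p.1 ^ 4 + p.1 ^ 6 + p.2 ^ 2) * (p.1 ^ 4 + p.1 ^ 6 + p.2 ^ 2) := by gcongr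
    _ = _ := by ring

theorem abs_perturbSnd_lt_one (p : Plane) : |perturbSnd p| < 1 := by
  rcases eq_or_ne p 0 with rfl | hp
  · simp [perturbSnd]
  refine (abs_perturbSnd_le p).trans_lt ((div_lt_one (denom_pos hp)).2 ?_)
  by_cases h : p.1 = 0
  · have : p.2 ≠ 0 := fun h' => hp (Prod.ext h h')
    rw [h]
    have : 0 < p.2 ^ 2 := by positivity
    linarith
  · have : 0 < p.1 ^ 6 := by positivity
    nlinarith [sq_nonneg p.2]

theorem tendsto_perturb_zero : Tendsto perturb (𝓝 0) (𝓝 0) := by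
  have h : Tendsto (fun p : Plane => p.1 ^ 2) (𝓝 0) (𝓝 0) := by
    have : Continuous fun p : Plane => p.1 ^ 2 := by fun_prop
    simpa using this.tendsto 0
  exact squeeze_zero_norm abs_perturb_le h

theorem tendsto_perturbFst_zero : Tendsto perturbFst (𝓝 0) (𝓝 0) := by
  have h : Tendsto (fun p : Plane => 2 * |p.1| + |p.1| ^ 3) (𝓝 0) (𝓝 0) := by
    have : Continuous fun p : Plane => 2 * |p.1| + |p.1| ^ 3 := by fun_prop
    simpa using this.tendsto 0
  exact squeeze_zero_norm abs_perturbFst_le h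

theorem continuous_perturb : Continuous perturb := by
  refine continuous_iff_continuousAt.2 fun p => ?_
  rcases eq_or_ne p 0 with rfl | hp
  · rw [ContinuousAt, perturb_zero]
    exact tendsto_perturb_zero
  · unfold perturb
    exact ContinuousAt.div (by fun_prop) (by fun_prop) (denom_pos hp).ne'

theorem continuousAt_perturbFst {p : Plane} (hp : p ≠ 0) : ContinuousAt perturbFst p := by
  unfold perturbFst
  exact ContinuousAt.div (by fun_prop) (by fun_prop) (pow_pos (denom_pos hp) 2).ne'

theorem continuousAt_perturbSnd {p : Plane} (hp : p ≠ 0) : ContinuousAt perturbSnd p := by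
  unfold perturbSnd
  exact ContinuousAt.div (by fun_prop) (by fun_prop) (pow_pos (denom_pos hp) 2).ne'

/-- A fibrewise increasing homeomorphism of the plane, of class C¹ away from the origin, whose
vertical stretching factor degenerates along the horizontal axis towards the origin. -/
def shear (p : Plane) : Plane := (p.1, p.2 - perturb p)

theorem continuous_shear : Continuous shear :=
  continuous_fst.prodMk (continuous_snd.sub continuous_perturb)

theorem strictMono_shear_snd (x : ℝ) : StrictMono fun y => y - perturb (x, y) := by
  intro a b hab
  rcases eq_or_ne x 0 with rfl | hx
  · simpa [perturb] using hab
  have hx4 : 0 < x ^ 4 := by positivity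
  have hx6 : 0 < x ^ 6 := by positivity
  have hA : 0 < x ^ 4 + x ^ 6 + a ^ 2 := by positivity
  have hB : 0 < x ^ 4 + x ^ 6 + b ^ 2 := by positivity
  have key : x ^ 4 * (x ^ 4 + x ^ 6 - a * b) <
      (x ^ 4 + x ^ 6 + a ^ 2) * (x ^ 4 + x ^ 6 + b ^ 2) := by
    nlinarith [mul_pos hx4 hx6, sq_nonneg (x ^ 3 * x ^ 3), sq_nonneg (a * b),
      mul_nonneg hx4.le (sq_nonneg (a + b)), mul_nonneg hx4.le (sq_nonneg a),
      mul_nonneg hx4.le (sq_nonneg b), mul_nonneg hx6.le (sq_nonneg a),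
      mul_nonneg hx6.le (sq_nonneg b)]
  have e : (b - perturb (x, b)) - (a - perturb (x, a)) = (b - a) *
      ((x ^ 4 + x ^ 6 + a ^ 2) * (x ^ 4 + x ^ 6 + b ^ 2) - x ^ 4 * (x ^ 4 + x ^ 6 - a * b)) /
        ((x ^ 4 + x ^ 6 + a ^ 2) * (x ^ 4 + x ^ 6 + b ^ 2)) := by
    simp only [perturb]
    field_simp
    ring
  have : 0 < (b - perturb (x, b)) - (a - perturb (x, a)) := by
    rw [e]
    exact div_pos (mul_pos (sub_pos.2 hab) (sub_pos.2 key)) (mul_pos hA hB)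
  simpa using sub_pos.1 this

theorem injective_shear : Function.Injective shear := by
  rintro ⟨x, y⟩ ⟨x', y'⟩ h
  obtain ⟨rfl, h2⟩ := Prod.mk.inj h
  exact Prod.ext rfl ((strictMono_shear_snd x).injective h2)

theorem surjective_shear : Function.Surjective shear := by
  rintro ⟨x, z⟩
  have hc : Continuous fun y : ℝ => y - perturb (x, y) :=
    continuous_id.sub (continuous_perturb.comp (by fun_prop))
  have h1 := (abs_le.1 (abs_perturb_le (x, z - x ^ 2))).1
  have h2 := (abs_le.1 (abs_perturb_le (x, z + x ^ 2))).2
  obtain ⟨y, -, hy⟩ := intermediate_value_Icc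
    (by linarith [sq_nonneg x] : z - x ^ 2 ≤ z + x ^ 2) hc.continuousOn
    (show z ∈ _ from ⟨by simp only at h1 ⊢; linarith, by simp only at h2 ⊢; linarith⟩)
  exact ⟨(x, y), Prod.ext rfl hy⟩

/-- `shear` as a bijection. -/
def shearEquiv : Plane ≃ Plane := Equiv.ofBijective shear ⟨injective_shear, surjective_shear⟩

theorem shear_shearEquiv_symm (q : Plane) : shear (shearEquiv.symm q) = q :=
  shearEquiv.apply_symm_apply q

theorem shearEquiv_symm_fst (q : Plane) : (shearEquiv.symm q).1 = q.1 := by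
  have h := congrArg Prod.fst (shear_shearEquiv_symm q)
  exact h

theorem shearEquiv_symm_snd (q : Plane) :
    (shearEquiv.symm q).2 - perturb (q.1, (shearEquiv.symm q).2) = q.2 := by
  have h := congrArg Prod.snd (shear_shearEquiv_symm q)
  rwa [← Prod.mk.eta (p := shearEquiv.symm q), shearEquiv_symm_fst] at h

theorem shear_snd_lt_iff (q : Plane) (y : ℝ) :
    y - perturb (q.1, y) < q.2 ↔ y < (shearEquiv.symm q).2 := by
  conv_lhs => rw [← shearEquiv_symm_snd q]
  exact (strictMono_shear_snd q.1).lt_iff_lt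

theorem lt_shear_snd_iff (q : Plane) (y : ℝ) :
    q.2 < y - perturb (q.1, y) ↔ (shearEquiv.symm q).2 < y := by
  conv_lhs => rw [← shearEquiv_symm_snd q]
  exact (strictMono_shear_snd q.1).lt_iff_lt

theorem continuous_shearEquiv_symm : Continuous shearEquiv.symm := by
  have h1 : Continuous fun q => (shearEquiv.symm q).1 := by
    simpa only [shearEquiv_symm_fst] using continuous_fst
  have hc (y : ℝ) : Continuous fun q : Plane => y - perturb (q.1, y) :=
    continuous_const.sub (continuous_perturb.comp (by fun_prop))
  have h2 : Continuous fun q => (shearEquiv.symm q).2 := by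
    refine continuous_iff_continuousAt.2 fun q => tendsto_order.2 ⟨fun y hy => ?_, fun y hy => ?_⟩
    · filter_upwards [(hc y).continuousAt.eventually_lt continuous_snd.continuousAt
        ((shear_snd_lt_iff q y).2 hy)] with r hr using (shear_snd_lt_iff r y).1 hr
    · filter_upwards [continuous_snd.continuousAt.eventually_lt (hc y).continuousAt
        ((lt_shear_snd_iff q y).2 hy)] with r hr using (lt_shear_snd_iff r y).1 hr
  exact h1.prodMk h2

/-- `shear` as a homeomorphism. -/
def shearHomeo : Plane ≃ₜ Plane where
  toEquiv := shearEquiv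
  continuous_toFun := continuous_shear
  continuous_invFun := continuous_shearEquiv_symm

theorem hasDerivAt_perturb_comp {γ : ℝ → Plane} {v : Plane} {t : ℝ} (h : HasDerivAt γ v t) :
    HasDerivAt (fun s => perturb (γ s))
      (perturbFst (γ t) * v.1 + perturbSnd (γ t) * v.2) t := by
  have h1 : HasDerivAt (fun s => (γ s).1) v.1 t := h.fst
  have h2 : HasDerivAt (fun s => (γ s).2) v.2 t := h.snd
  rcases eq_or_ne (γ t) 0 with h0 | h0
  · rw [h0, perturbFst_zero, perturbSnd_zero, zero_mul, zero_mul, zero_add,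
      hasDerivAt_iff_isLittleO]
    have hO : (fun s => (γ s).1) =O[𝓝 t] fun s => s - t := by
      simpa [h0] using h1.isBigO_sub
    have ho : (fun s => (γ s).1) =o[𝓝 t] fun _ => (1 : ℝ) := by
      rw [Asymptotics.isLittleO_one_iff]
      simpa [h0] using h1.continuousAt.tendsto
    have : (fun s => perturb (γ s)) =O[𝓝 t] fun s => (γ s).1 * (γ s).1 :=
      Asymptotics.IsBigO.of_bound 1 (Eventually.of_forall fun s => by
        simpa [← sq] using abs_perturb_le (γ s))
    simpa [h0, perturb_zero] using this.trans_isLittleO (hO.mul_isLittleO ho)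
  · have hQ := denom_pos h0
    have := ((h1.pow 4).mul h2).div (((h1.pow 4).add (h1.pow 6)).add (h2.pow 2)) hQ.ne'
    convert! this using 1
    simp only [perturbFst, perturbSnd, Pi.add_apply, Pi.pow_apply, Pi.mul_apply]
    field_simp
    ring

theorem tendsto_perturbSnd_mul {γ : ℝ → Plane} {t : ℝ} (hγ : ContDiff ℝ 1 γ) (h0 : γ t = 0) :
    Tendsto (fun s => perturbSnd (γ s) * (deriv γ s).2) (𝓝 t) (𝓝 0) := by
  have hd : HasDerivAt γ (deriv γ t) t := (hγ.differentiable one_ne_zero t).hasDerivAt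
  have hc : Tendsto (fun s => (deriv γ s).2) (𝓝 t) (𝓝 (deriv γ t).2) :=
    (continuous_snd.comp (hγ.continuous_deriv le_rfl)).tendsto t
  by_cases hv : (deriv γ t).2 = 0
  · rw [hv] at hc
    exact bdd_le_mul_tendsto_zero' 1
      (Eventually.of_forall fun s => (abs_perturbSnd_lt_one _).le) hc
  · have h1 : HasDerivAt (fun s => (γ s).1) (deriv γ t).1 t := hd.fst
    have h2 : HasDerivAt (fun s => (γ s).2) (deriv γ t).2 t := hd.snd
    have hO : (fun s => (γ s).1) =O[𝓝 t] fun s => (γ s).2 := by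
      have a := h1.isBigO_sub
      have b := (h2.isTheta_sub hv).isBigO_symm.comp_tendsto
        (tendsto_id.prodMk (tendsto_pure.2 (Eventually.of_forall fun _ => rfl)))
      simp only [Function.comp_def, id, h0, Prod.fst_zero, Prod.snd_zero, sub_zero] at a b
      exact a.trans b
    obtain ⟨C, hC⟩ := hO.bound
    have hz : Tendsto (fun s => C ^ 2 * (γ s).1 ^ 2) (𝓝 t) (𝓝 0) := by
      have : Tendsto (fun s => C ^ 2 * (γ s).1 ^ 2) (𝓝 t) (𝓝 (C ^ 2 * (γ t).1 ^ 2)) :=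
        (h1.continuousAt.pow 2).const_mul _
      simpa [h0] using this
    have : Tendsto (fun s => perturbSnd (γ s)) (𝓝 t) (𝓝 0) := by
      refine squeeze_zero_norm' ?_ hz
      filter_upwards [hC] with s hs
      have hs' : (γ s).1 ^ 2 ≤ C ^ 2 * (γ s).2 ^ 2 := by
        simp only [Real.norm_eq_abs] at hs
        calc (γ s).1 ^ 2 = |(γ s).1| ^ 2 := (sq_abs _).symm
          _ ≤ (C * |(γ s).2|) ^ 2 := by gcongr
          _ = _ := by rw [mul_pow, sq_abs]
      refine (abs_perturbSnd_le _).trans (div_le_of_le_mul₀ (by positivity) (by positivity) ?_)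
      have : 0 ≤ C ^ 2 * (γ s).1 ^ 2 * ((γ s).1 ^ 4 + (γ s).1 ^ 6) := by positivity
      nlinarith [mul_le_mul_of_nonneg_left hs' (sq_nonneg (γ s).1)]
    simpa using this.mul hc

theorem continuous_deriv_perturb_comp {γ : ℝ → Plane} (hγ : ContDiff ℝ 1 γ) :
    Continuous fun s =>
      perturbFst (γ s) * (deriv γ s).1 + perturbSnd (γ s) * (deriv γ s).2 := by
  refine continuous_iff_continuousAt.2 fun t => ?_
  have hc := hγ.continuous
  have hd := hγ.continuous_deriv le_rfl
  have hd1 : ContinuousAt (fun s => (deriv γ s).1) t := (continuous_fst.comp hd).continuousAt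
  have hd2 : ContinuousAt (fun s => (deriv γ s).2) t := (continuous_snd.comp hd).continuousAt
  rcases eq_or_ne (γ t) 0 with h0 | h0
  · have h1 : Tendsto (fun s => perturbFst (γ s)) (𝓝 t) (𝓝 0) :=
      tendsto_perturbFst_zero.comp (h0 ▸ hc.tendsto t)
    simpa [ContinuousAt, h0, perturbFst_zero, perturbSnd_zero] using
      (h1.mul hd1.tendsto).add (tendsto_perturbSnd_mul hγ h0)
  · exact ((ContinuousAt.comp (continuousAt_perturbFst h0) hc.continuousAt).mul hd1).add
      ((ContinuousAt.comp (continuousAt_perturbSnd h0) hc.continuousAt).mul hd2)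

theorem one_sub_perturbSnd_ne_zero (p : Plane) : 1 - perturbSnd p ≠ 0 :=
  (sub_pos.2 (abs_lt.1 (abs_perturbSnd_lt_one p)).2).ne'

/-- The derivative of `shear` at `p`. -/
def shearDeriv (p : Plane) : Plane ≃L[ℝ] Plane where
  toFun v := (v.1, (1 - perturbSnd p) * v.2 - perturbFst p * v.1)
  map_add' v w := Prod.ext rfl (by simp; ring)
  map_smul' c v := Prod.ext rfl (by simp; ring)
  invFun v := (v.1, (v.2 + perturbFst p * v.1) / (1 - perturbSnd p))
  left_inv v := Prod.ext rfl (by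
    have := one_sub_perturbSnd_ne_zero p
    simp only
    field_simp
    ring)
  right_inv v := Prod.ext rfl (by
    have := one_sub_perturbSnd_ne_zero p
    simp only
    field_simp
    ring)
  continuous_toFun := by fun_prop
  continuous_invFun := by fun_prop

theorem hasDerivAt_shear_comp {γ : ℝ → Plane} {v : Plane} {t : ℝ} (h : HasDerivAt γ v t) :
    HasDerivAt (shear ∘ γ) (shearDeriv (γ t) v) t := by
  have h1 : HasDerivAt (fun s => (γ s).1) v.1 t := h.fst
  have h2 : HasDerivAt (fun s => (γ s).2) v.2 t := h.snd
  convert! h1.prodMk (h2.sub (hasDerivAt_perturb_comp h)) using 1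
  exact Prod.ext rfl (show (1 - perturbSnd (γ t)) * v.2 - perturbFst (γ t) * v.1 = _ by ring)

theorem IsRegParam.hasDerivAt {γ : ℝ → Plane} (h : IsRegParam γ) (t : ℝ) :
    HasDerivAt γ (deriv γ t) t :=
  (h.1.differentiable one_ne_zero t).hasDerivAt

theorem IsRegParam.shear_comp {γ : ℝ → Plane} (h : IsRegParam γ) : IsRegParam (shear ∘ γ) := by
  have hd (t : ℝ) := hasDerivAt_shear_comp (h.hasDerivAt t)
  refine ⟨contDiff_one_iff_deriv.2 ⟨fun t => (hd t).differentiableAt, ?_⟩,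
    fun t => congrArg shear (h.2.1 t), injective_shear.comp_injOn h.2.2.1, fun t => ?_⟩
  · have h1 : Continuous fun t => (deriv γ t).1 :=
      continuous_fst.comp (h.1.continuous_deriv le_rfl)
    have h2 : Continuous fun t => (deriv γ t).2 :=
      continuous_snd.comp (h.1.continuous_deriv le_rfl)
    convert! h1.prodMk (h2.sub (continuous_deriv_perturb_comp h.1)) using 1
    funext t
    rw [(hd t).deriv]
    exact Prod.ext rfl (show (1 - perturbSnd (γ t)) * (deriv γ t).2 -
      perturbFst (γ t) * (deriv γ t).1 = (deriv γ t).2 -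
      (perturbFst (γ t) * (deriv γ t).1 + perturbSnd (γ t) * (deriv γ t).2) by ring)
  · rw [(hd t).deriv]
    exact (map_ne_zero_iff _ (shearDeriv (γ t)).injective).2 (h.2.2.2 t)

theorem mapsC1_shear : MapsC1 shear := by
  rintro _ ⟨γ, hγ, rfl⟩
  exact ⟨shear ∘ γ, hγ.shear_comp, (Set.range_comp shear γ).symm⟩

theorem continuous_projectivization_map (L : Plane ≃L[ℝ] Plane) :
    Continuous (Projectivization.map (L : Plane →ₗ[ℝ] Plane) L.injective :
      ProjLine → ProjLine) :=
  Continuous.quotient_map' ((L.continuous.comp continuous_subtype_val).subtype_mk _) _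

/-- The homeomorphism of the projective line induced by a linear automorphism of the plane. -/
def projHomeo (L : Plane ≃L[ℝ] Plane) : ProjLine ≃ₜ ProjLine where
  toFun := Projectivization.map (L : Plane →ₗ[ℝ] Plane) L.injective
  invFun := Projectivization.map (L.symm : Plane →ₗ[ℝ] Plane) L.symm.injective
  left_inv ℓ := by
    induction ℓ using Projectivization.ind with
    | h v hv => simp [Projectivization.map_mk]
  right_inv ℓ := by
    induction ℓ using Projectivization.ind with
    | h v hv => simp [Projectivization.map_mk]
  continuous_toFun := continuous_projectivization_map L
  continuous_invFun := continuous_projectivization_map L.symm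

theorem inducesAt_shear (p : Plane) : InducesAt shear p (projHomeo (shearDeriv p)) := by
  rintro _ _ ⟨γ, t, h, rfl, rfl, rfl⟩
  refine ⟨mapsC1_shear _ ⟨γ, h, rfl⟩, shear ∘ γ, t, h.shear_comp,
    (Set.range_comp shear γ).symm, rfl, ?_⟩
  have hd := (hasDerivAt_shear_comp (h.hasDerivAt t)).deriv
  simp only [hd]
  rfl

theorem IsRegParam.eventually_exists_mem {δ : ℝ → Plane} (h : IsRegParam δ) (t₀ : ℝ) {U : Set ℝ}
    (hU : U ∈ 𝓝 t₀) : ∀ᶠ p in 𝓝 (δ t₀), p ∈ Set.range δ → ∃ t ∈ U, δ t = p := by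
  set K := Set.Icc (t₀ - 1 / 2) (t₀ + 1 / 2) \ interior U with hK
  have hKc : IsCompact (δ '' K) := (isCompact_Icc.diff isOpen_interior).image h.1.continuous
  have hnot : δ t₀ ∉ δ '' K := by
    rintro ⟨t, ⟨⟨ht1, ht2⟩, htU⟩, hteq⟩
    have hf : Int.fract t = Int.fract t₀ := by
      refine h.2.2.1 ⟨Int.fract_nonneg _, Int.fract_lt_one _⟩
        ⟨Int.fract_nonneg _, Int.fract_lt_one _⟩ ?_
      have e (u : ℝ) : δ (Int.fract u) = δ u := by
        have := h.2.1.sub_zsmul_eq (x := u) ⌊u⌋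
        rwa [zsmul_one, Int.self_sub_floor] at this
      rw [e, e, hteq]
    obtain ⟨k, hk⟩ := Int.fract_eq_fract.1 hf
    have hk0 : k = 0 := by
      have h1 : (k : ℝ) < 1 := by linarith
      have h2 : (-1 : ℝ) < k := by linarith
      have h1' : k < 1 := by exact_mod_cast h1
      have h2' : -1 < k := by exact_mod_cast h2
      omega
    rw [hk0, Int.cast_zero] at hk
    exact htU (by rw [sub_eq_zero.1 hk]; exact mem_interior_iff_mem_nhds.2 hU)
  filter_upwards [hKc.isClosed.isOpen_compl.mem_nhds hnot]
  rintro _ hp ⟨t, rfl⟩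
  obtain ⟨u, ⟨hu1, hu2⟩, hut⟩ := Function.Periodic.exists_mem_Ico h.2.1 one_pos t (t₀ - 1 / 2)
  refine ⟨u, by_contra fun hu => hp ⟨u, ⟨⟨hu1, by linarith⟩, fun h' => hu (interior_subset h')⟩,
    hut.symm⟩, hut.symm⟩

theorem IsRegParam.exists_nhds_chord {δ : ℝ → Plane} (h : IsRegParam δ) (t₀ : ℝ) {c : ℝ}
    (hc : 0 < c) : ∃ U ∈ 𝓝 t₀, ∀ s ∈ U, ∀ t ∈ U,
      |(δ s).1 - (δ t).1 - (s - t) * (deriv δ t₀).1| ≤ c * |s - t| ∧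
      |(δ s).2 - (δ t).2 - (s - t) * (deriv δ t₀).2| ≤ c * |s - t| := by
  have hs : HasStrictDerivAt δ (deriv δ t₀) t₀ := h.1.contDiffAt.hasStrictDerivAt one_ne_zero
  have := (hasDerivAtFilter_iff_isLittleO.1 hs).bound hc
  rw [nhds_prod_eq] at this
  obtain ⟨U, hU, hb⟩ := eventually_prod_self_iff'.1 this
  refine ⟨U, hU, fun s hs t ht => ?_⟩
  have := hb s hs t ht
  rw [Prod.norm_def, max_le_iff] at this
  simpa using this

/-- A `C¹` function vanishing near `1` which separates `c` from `-c`. -/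
def ramp (c : ℝ) : ℝ := max (1 / 2 - c) 0 ^ 2

theorem hasDerivAt_ramp (c : ℝ) : HasDerivAt ramp (-(2 * max (1 / 2 - c) 0)) c := by
  rw [hasDerivAt_iff_isLittleO]
  have ho : (fun s : ℝ => s - c) =o[𝓝 c] fun _ => (1 : ℝ) := by
    rw [Asymptotics.isLittleO_one_iff]
    simpa using (by fun_prop : Continuous fun s : ℝ => s - c).tendsto c
  have hO : (fun s => ramp s - ramp c - (s - c) • -(2 * max (1 / 2 - c) 0)) =O[𝓝 c]
      fun s => (s - c) * (s - c) := by
    refine Asymptotics.IsBigO.of_bound 1 (Eventually.of_forall fun s => ?_)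
    rw [Real.norm_eq_abs, Real.norm_eq_abs, abs_mul_self, one_mul, smul_eq_mul, abs_le]
    unfold ramp
    rcases max_cases (1 / 2 - s) 0 with ⟨h1, h1'⟩ | ⟨h1, h1'⟩ <;>
    rcases max_cases (1 / 2 - c) 0 with ⟨h2, h2'⟩ | ⟨h2, h2'⟩ <;> rw [h1, h2] <;>
    constructor <;> nlinarith [sq_nonneg (s - c), sq_nonneg (1 / 2 - s), sq_nonneg (1 / 2 - c)]
  simpa using hO.trans_isLittleO ((Asymptotics.isBigO_refl _ _).mul_isLittleO ho)

theorem contDiff_ramp : ContDiff ℝ 1 ramp := by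
  refine contDiff_one_iff_deriv.2 ⟨fun c => (hasDerivAt_ramp c).differentiableAt, ?_⟩
  rw [funext fun c => (hasDerivAt_ramp c).deriv]
  fun_prop

theorem ramp_eq_zero {c : ℝ} (hc : 1 / 2 ≤ c) : ramp c = 0 := by
  rw [ramp, max_eq_right (sub_nonpos.2 hc), zero_pow two_ne_zero]

theorem eq_zero_of_ramp_neg {c : ℝ} (h : ramp c = ramp (-c)) : c = 0 := by
  unfold ramp at h
  rw [sq_eq_sq₀ (le_max_right _ _) (le_max_right _ _)] at h
  grind

/-- A `C¹` function with slopes of order `x` at zeros accumulating at the origin. -/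
def flatOscillation (x : ℝ) : ℝ := x ^ 4 * Real.sin (1 / x ^ 2)

theorem hasDerivAt_flatOscillation (x : ℝ) : HasDerivAt flatOscillation
    (4 * x ^ 3 * Real.sin (1 / x ^ 2) - 2 * x * Real.cos (1 / x ^ 2)) x := by
  rcases eq_or_ne x 0 with rfl | hx
  · rw [hasDerivAt_iff_isLittleO]
    have hO : flatOscillation =O[𝓝 0] fun s => s ^ 4 := by
      refine Asymptotics.IsBigO.of_bound 1 (Eventually.of_forall fun s => ?_)
      rw [flatOscillation, norm_mul, mul_comm]
      gcongr
      exact Real.abs_sin_le_one _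
    have : (fun s : ℝ => s ^ 4) =o[𝓝 0] fun s => s := by
      simpa using Asymptotics.isLittleO_pow_pow (𝕜 := ℝ) (m := 1) (n := 4) (by norm_num)
    simpa [show flatOscillation 0 = 0 by simp [flatOscillation]] using hO.trans_isLittleO this
  · have h1 : HasDerivAt (fun x : ℝ => 1 / x ^ 2) (-2 / x ^ 3) x := by
      convert! (hasDerivAt_const x (1 : ℝ)).div (hasDerivAt_pow 2 x) (pow_ne_zero 2 hx) using 1
      field_simp
      ring
    convert! (hasDerivAt_pow 4 x).mul h1.sin using 1
    field_simp
    ring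

theorem contDiff_flatOscillation : ContDiff ℝ 1 flatOscillation := by
  refine contDiff_one_iff_deriv.2 ⟨fun x => (hasDerivAt_flatOscillation x).differentiableAt, ?_⟩
  rw [funext fun x => (hasDerivAt_flatOscillation x).deriv]
  have h1 : Continuous fun x : ℝ => 4 * x ^ 3 * Real.sin (1 / x ^ 2) := by
    refine continuous_iff_continuousAt.2 fun x => ?_
    rcases eq_or_ne x 0 with rfl | hx
    · have : Tendsto (fun x : ℝ => Real.sin (1 / x ^ 2) * (4 * x ^ 3)) (𝓝 0) (𝓝 0) :=
        bdd_le_mul_tendsto_zero' 1 (Eventually.of_forall fun x => Real.abs_sin_le_one _)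
          (by simpa using (by fun_prop : Continuous fun x : ℝ => 4 * x ^ 3).tendsto 0)
      simpa [ContinuousAt, mul_comm] using this
    · have : x ^ 2 ≠ 0 := pow_ne_zero 2 hx
      fun_prop (disch := assumption)
  have h2 : Continuous fun x : ℝ => 2 * x * Real.cos (1 / x ^ 2) := by
    refine continuous_iff_continuousAt.2 fun x => ?_
    rcases eq_or_ne x 0 with rfl | hx
    · have : Tendsto (fun x : ℝ => Real.cos (1 / x ^ 2) * (2 * x)) (𝓝 0) (𝓝 0) :=
        bdd_le_mul_tendsto_zero' 1 (Eventually.of_forall fun x => Real.abs_cos_le_one _)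
          (by simpa using (by fun_prop : Continuous fun x : ℝ => 2 * x).tendsto 0)
      simpa [ContinuousAt, mul_comm] using this
    · have : x ^ 2 ≠ 0 := pow_ne_zero 2 hx
      fun_prop (disch := assumption)
  exact h1.sub h2

/-- A closed curve which near the origin is the graph of `flatOscillation`. -/
def oscillatingCurve (t : ℝ) : Plane :=
  (Real.sin (2 * Real.pi * t),
    flatOscillation (Real.sin (2 * Real.pi * t)) + ramp (Real.cos (2 * Real.pi * t)))

theorem isRegParam_oscillatingCurve : IsRegParam oscillatingCurve := by
  have hsin (t : ℝ) : HasDerivAt (fun t => Real.sin (2 * Real.pi * t))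
      (Real.cos (2 * Real.pi * t) * (2 * Real.pi)) t := by
    simpa using ((hasDerivAt_id t).const_mul (2 * Real.pi)).sin
  have hcos (t : ℝ) : HasDerivAt (fun t => Real.cos (2 * Real.pi * t))
      (-Real.sin (2 * Real.pi * t) * (2 * Real.pi)) t := by
    simpa using ((hasDerivAt_id t).const_mul (2 * Real.pi)).cos
  refine ⟨?_, fun t => ?_, ?_, fun t ht => ?_⟩
  · have hs : ContDiff ℝ 1 fun t => Real.sin (2 * Real.pi * t) := by fun_prop
    have hc : ContDiff ℝ 1 fun t => Real.cos (2 * Real.pi * t) := by fun_prop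
    exact hs.prodMk ((contDiff_flatOscillation.comp hs).add (contDiff_ramp.comp hc))
  · simp [oscillatingCurve, mul_add]
  · intro s hs t ht hst
    obtain ⟨h1, h2⟩ := Prod.mk.inj hst
    rw [h1, add_right_inj] at h2
    have hcs : Real.cos (2 * Real.pi * s) = Real.cos (2 * Real.pi * t) := by
      have : Real.cos (2 * Real.pi * s) ^ 2 = Real.cos (2 * Real.pi * t) ^ 2 := by
        rw [Real.cos_sq', Real.cos_sq', h1]
      rcases sq_eq_sq_iff_eq_or_eq_neg.1 this with h | h
      · exact h
      · rw [h] at h2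
        rw [h, eq_zero_of_ramp_neg h2.symm, neg_zero]
    obtain ⟨k, hk⟩ := Real.Angle.angle_eq_iff_two_pi_dvd_sub.1 (Real.Angle.cos_sin_inj hcs h1)
    have hk' : s - t = k := by
      have := Real.two_pi_pos.ne'
      exact mul_left_cancel₀ this (by linarith)
    have hk0 : k = 0 := by
      have h1 : (k : ℝ) < 1 := by linarith [hs.2, ht.1]
      have h2 : (-1 : ℝ) < k := by linarith [hs.1, ht.2]
      have h1' : k < 1 := by exact_mod_cast h1
      have h2' : -1 < k := by exact_mod_cast h2
      omega
    rw [hk0, Int.cast_zero] at hk'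
    exact sub_eq_zero.1 hk'
  · have hd : HasDerivAt oscillatingCurve _ t :=
      (hsin t).prodMk (((hasDerivAt_flatOscillation _).comp t (hsin t)).add
        ((hasDerivAt_ramp _).comp t (hcos t)))
    rw [hd.deriv] at ht
    obtain ⟨h1, h2⟩ := Prod.mk.inj ht
    have hc : Real.cos (2 * Real.pi * t) = 0 := by simpa [Real.pi_ne_zero] using h1
    have hs : Real.sin (2 * Real.pi * t) ≠ 0 := fun h => by
      simpa [h, hc] using Real.sin_sq_add_cos_sq (2 * Real.pi * t)
    simp [hc, hs, Real.pi_ne_zero] at h2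

theorem mem_range_oscillatingCurve {x : ℝ} (h0 : 0 ≤ x) (h1 : x ≤ 1 / 2) :
    (x, flatOscillation x) ∈ Set.range oscillatingCurve := by
  refine ⟨Real.arcsin x / (2 * Real.pi), ?_⟩
  have e : 2 * Real.pi * (Real.arcsin x / (2 * Real.pi)) = Real.arcsin x :=
    mul_div_cancel₀ _ Real.two_pi_pos.ne'
  have : 1 / 2 ≤ √(1 - x ^ 2) := Real.le_sqrt_of_sq_le (by nlinarith)
  rw [oscillatingCurve, e, Real.sin_arcsin (by linarith) (by linarith), Real.cos_arcsin,
    ramp_eq_zero this, add_zero]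

theorem shear_zero : shear 0 = 0 := by simp [shear, perturb_zero]

theorem cube_le_shearEquiv_symm {x : ℝ} (h0 : 0 < x) :
    x ^ 3 ≤ (shearEquiv.symm (x, x ^ 4)).2 := by
  refine not_lt.1 fun h => ?_
  have h2 := (lt_shear_snd_iff (x, x ^ 4) (x ^ 3)).2 h
  have h3 : x ^ 3 - perturb (x, x ^ 3) = 2 * x ^ 5 / (1 + 2 * x ^ 2) := by
    simp only [perturb]
    field_simp
    ring
  rw [h3, lt_div_iff₀ (by positivity)] at h2
  have : 0 < x ^ 4 := by positivity
  nlinarith [mul_nonneg this.le (sq_nonneg (x - 1)), mul_pos this (sq_pos_of_pos h0)]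

theorem inv_sqrt_sub_le {a b : ℝ} (ha : 0 < a) (hab : a ≤ b) :
    1 / √a - 1 / √b ≤ (b - a) * (1 / √a) ^ 3 := by
  have hb := ha.trans_le hab
  set p := 1 / √a with hp
  set q := 1 / √b with hq
  have hp0 : 0 < p := by positivity
  have hq0 : 0 < q := by positivity
  have hqp : q ≤ p := one_div_le_one_div_of_le (Real.sqrt_pos.2 ha) (Real.sqrt_le_sqrt hab)
  have hpa : p ^ 2 * a = 1 := by rw [hp, div_pow, Real.sq_sqrt ha.le]; field_simp
  have hqb : q ^ 2 * b = 1 := by rw [hq, div_pow, Real.sq_sqrt hb.le]; field_simp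
  have e : (p - q) * (p + q) = (b - a) * (p ^ 2 * q ^ 2) := by
    linear_combination q ^ 2 * hpa - p ^ 2 * hqb
  have hba := sub_nonneg.2 hab
  refine le_of_mul_le_mul_right ?_ hp0
  calc (p - q) * p ≤ (p - q) * (p + q) := by
        gcongr
        linarith
    _ = (b - a) * (p ^ 2 * q ^ 2) := e
    _ ≤ (b - a) * (p ^ 2 * p ^ 2) := by gcongr
    _ = (b - a) * p ^ 3 * p := by ring

theorem flatOscillation_inv_sqrt {a : ℝ} (ha : 0 < a) :
    flatOscillation (1 / √a) = (1 / √a) ^ 4 * Real.sin a := by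
  rw [flatOscillation, div_pow 1 _ 2, Real.sq_sqrt ha.le, one_pow, one_div_one_div]

theorem not_isC1Curve_preimage_oscillatingCurve :
    ¬ IsC1Curve (shear ⁻¹' Set.range oscillatingCurve) := by
  rintro ⟨δ, hδ, hrange⟩
  have hmem {p : Plane} (hp : shear p ∈ Set.range oscillatingCurve) : p ∈ Set.range δ :=
    hrange ▸ hp
  obtain ⟨t₀, ht₀⟩ : (0 : Plane) ∈ Set.range δ := hmem (by
    have := mem_range_oscillatingCurve le_rfl (by norm_num : (0 : ℝ) ≤ 1 / 2)
    rwa [show flatOscillation 0 = 0 by simp [flatOscillation], Prod.mk_zero_zero,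
      ← shear_zero] at this)
  let a : ℕ → ℝ := fun n => Real.pi / 2 + n * (2 * Real.pi)
  let b : ℕ → ℝ := fun n => Real.pi + n * (2 * Real.pi)
  have hpi := Real.pi_pos
  have ha (n : ℕ) : 0 < a n := by positivity
  have hb (n : ℕ) : 0 < b n := by positivity
  have hab (n : ℕ) : b n - a n = Real.pi / 2 := by simp only [a, b]; ring
  have hsa (n : ℕ) : Real.sin (a n) = 1 := by
    rw [Real.sin_add_nat_mul_two_pi, Real.sin_pi_div_two]
  have hsb (n : ℕ) : Real.sin (b n) = 0 := by
    rw [Real.sin_add_nat_mul_two_pi, Real.sin_pi]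
  have hlin : Tendsto (fun n : ℕ => (n : ℝ) * (2 * Real.pi)) atTop atTop :=
    tendsto_natCast_atTop_atTop.atTop_mul_const Real.two_pi_pos
  have hp : Tendsto (fun n => 1 / √(a n)) atTop (𝓝 0) := by
    simpa only [one_div, Function.comp_def] using tendsto_inv_atTop_zero.comp
      (Real.tendsto_sqrt_atTop.comp (tendsto_atTop_add_const_left _ (Real.pi / 2) hlin))
  have hq : Tendsto (fun n => 1 / √(b n)) atTop (𝓝 0) := by
    simpa only [one_div, Function.comp_def] using tendsto_inv_atTop_zero.comp
      (Real.tendsto_sqrt_atTop.comp (tendsto_atTop_add_const_left _ Real.pi hlin))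
  let P : ℕ → Plane := fun n => (1 / √(b n), 0)
  let Q : ℕ → Plane := fun n => shearEquiv.symm (1 / √(a n), (1 / √(a n)) ^ 4)
  have hP : Tendsto P atTop (𝓝 (δ t₀)) := ht₀ ▸ hq.prodMk_nhds tendsto_const_nhds
  have hQ : Tendsto Q atTop (𝓝 (δ t₀)) := by
    have h0 : shearEquiv.symm 0 = 0 := shearEquiv.symm_apply_eq.2 shear_zero.symm
    have h1 : Tendsto (fun n => (1 / √(a n), (1 / √(a n)) ^ 4)) atTop (𝓝 (0 : Plane)) := by
      have := hp.prodMk_nhds (hp.pow 4)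
      rwa [zero_pow four_ne_zero] at this
    have := (continuous_shearEquiv_symm.tendsto 0).comp h1
    rwa [h0, ← ht₀] at this
  have hps : ∀ᶠ n in atTop, 1 / √(a n) ≤ 1 / 2 := hp.eventually_le_const (by norm_num)
  have hqs : ∀ᶠ n in atTop, 1 / √(b n) ≤ 1 / 2 := hq.eventually_le_const (by norm_num)
  have hlift (c : ℝ) (hc : 0 < c) : ∃ n s t, δ s = P n ∧ δ t = Q n ∧
      |(δ s).2 - (δ t₀).2 - (s - t₀) * (deriv δ t₀).2| ≤ c * |s - t₀| ∧
      |(δ t).1 - (δ s).1 - (t - s) * (deriv δ t₀).1| ≤ c * |t - s| ∧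
      |(δ t).2 - (δ s).2 - (t - s) * (deriv δ t₀).2| ≤ c * |t - s| := by
    obtain ⟨U, hU, hchord⟩ := hδ.exists_nhds_chord t₀ hc
    have hev := hδ.eventually_exists_mem t₀ hU
    obtain ⟨n, h1, h2, h3, h4⟩ :=
      (hps.and (hqs.and ((hP.eventually hev).and (hQ.eventually hev)))).exists
    obtain ⟨s, hs, hsP⟩ := h3 (hmem (by
      have := mem_range_oscillatingCurve (by positivity) h2
      rw [flatOscillation_inv_sqrt (hb n), hsb, mul_zero] at this
      simpa [P, shear, perturb] using this))
    obtain ⟨t, ht, htQ⟩ := h4 (hmem (by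
      have := mem_range_oscillatingCurve (by positivity) h1
      rw [flatOscillation_inv_sqrt (ha n), hsa, mul_one] at this
      rwa [shear_shearEquiv_symm]))
    exact ⟨n, s, t, hsP, htQ, (hchord s hs t₀ (mem_of_mem_nhds hU)).2, hchord t ht s hs⟩
  have hv2 : (deriv δ t₀).2 = 0 := by
    by_contra hne
    have hpos := abs_pos.2 hne
    obtain ⟨n, s, t, hs, -, h, -⟩ := hlift (|(deriv δ t₀).2| / 2) (half_pos hpos)
    rw [hs, ht₀] at h
    simp only [P, Prod.snd_zero, sub_zero, zero_sub, abs_neg, abs_mul] at h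
    have hst : |s - t₀| = 0 := le_antisymm (by nlinarith) (abs_nonneg _)
    rw [sub_eq_zero.1 (abs_eq_zero.1 hst), ht₀] at hs
    have : (0 : ℝ) = 1 / √(b n) := congrArg Prod.fst hs
    have : 0 < 1 / √(b n) := one_div_pos.2 (Real.sqrt_pos.2 (hb n))
    linarith
  have hv1 : 0 < |(deriv δ t₀).1| :=
    abs_pos.2 fun h => hδ.2.2.2 t₀ (Prod.ext h hv2)
  obtain ⟨n, s, t, hs, ht, -, h1, h2⟩ := hlift (|(deriv δ t₀).1| / 4) (by positivity)
  have hp0 : 0 < 1 / √(a n) := one_div_pos.2 (Real.sqrt_pos.2 (ha n))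
  have hcube := cube_le_shearEquiv_symm hp0
  have hdist := inv_sqrt_sub_le (ha n) (by linarith [hab n] : a n ≤ b n)
  have hmono : 1 / √(b n) ≤ 1 / √(a n) := by
    have := Real.sqrt_pos.2 (ha n)
    gcongr
    linarith [hab n]
  rw [hs, ht, shearEquiv_symm_fst] at h1
  rw [hs, ht, hv2] at h2
  simp only [P, Q, mul_zero, sub_zero] at h1 h2
  have h3 : |t - s| * |(deriv δ t₀).1| ≤ (1 / √(a n) - 1 / √(b n)) +
      |(deriv δ t₀).1| / 4 * |t - s| := by
    rw [← abs_mul, ← abs_of_nonneg (sub_nonneg.2 hmono)]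
    have := abs_sub_abs_le_abs_sub ((t - s) * (deriv δ t₀).1) (1 / √(a n) - 1 / √(b n))
    rw [abs_sub_comm] at h1
    linarith
  have hx : 0 < (1 / √(a n)) ^ 3 := by positivity
  rw [hab] at hdist
  have hpi4 := Real.pi_lt_four
  have h4 := (le_abs_self _).trans h2
  nlinarith

/-- There is a homeomorphism of the plane mapping every C¹ curve to a C¹ curve and
inducing homeomorphisms of projective tangent spaces at every point, whose inverse
nevertheless fails to map some C¹ curve to a C¹ curve; so it is not in `Homeo¹(ℝ²)`. -/
theorem exists_non_homeo1_with_properties_a_b :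
    ∃ f : Plane ≃ₜ Plane,
      MapsC1 ⇑f ∧
      (∀ p : Plane, ∃ φ : ProjLine ≃ₜ ProjLine, InducesAt ⇑f p φ) ∧
      (∃ Γ : Set Plane, IsC1Curve Γ ∧ ¬ IsC1Curve (⇑f ⁻¹' Γ)) ∧
      ¬ InHomeo1 f := by
  have hΓ : IsC1Curve (Set.range oscillatingCurve) :=
    ⟨oscillatingCurve, isRegParam_oscillatingCurve, rfl⟩
  refine ⟨shearHomeo, mapsC1_shear, fun p => ⟨_, inducesAt_shear p⟩,
    ⟨_, hΓ, not_isC1Curve_preimage_oscillatingCurve⟩, fun h => ?_⟩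
  have := h.2 _ hΓ
  rw [Homeomorph.image_symm] at this
  exact not_isC1Curve_preimage_oscillatingCurve this
end
end
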